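/- (Whitney decomposition plus bilinear input.) Assume BH(s,r) holds for some 3/2 < s < 2 and r < s'. Then there is a constant C such that for every measurable set Ω' ⊆ [0,1]² of finite measure, ∥𝓔χ_{Ω'}∥_{L^{2s}(ℝ³)}² ≤ C Σ_{j ≥ 0} Σ_{k ≥ 0} 2^{-(j+k)(2 − 2/s − 2/r)} · (max_{τ ∈ 𝓓_{j,k}} |Ω' ∩ τ|)^{2/r − 1/s} · |Ω'|^{1/s}. -/

import Mathlib

open MeasureTheory Set
open scoped ENNReal

/-- The extension operator for the hyperbolic paraboloid `τ = ξ₁ξ₂` in `ℝ³`: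
`𝓔f(t,x) = ∫_{ℝ²} e^{i(tξ₁ξ₂ + x·ξ)} f(ξ) dξ`. -/
noncomputable def extOp (f : ℝ × ℝ → ℂ) (p : ℝ × ℝ × ℝ) : ℂ :=
  ∫ ξ : ℝ × ℝ,
    Complex.exp (Complex.I * (p.1 * ξ.1 * ξ.2 + p.2.1 * ξ.1 + p.2.2 * ξ.2 : ℝ)) * f ξ

/-- Characteristic function of a set, valued in `ℂ`. -/
noncomputable def chi (Ω : Set (ℝ × ℝ)) : ℝ × ℝ → ℂ := Ω.indicator fun _ => 1

/-- The axis-parallel unit square with lower-left corner `(a, b)`. -/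
def unitSq (a b : ℝ) : Set (ℝ × ℝ) := Icc a (a + 1) ×ˢ Icc b (b + 1)

/-- Bilinear hypothesis BH(s,r) with constant `A`: a bilinear adjoint restriction estimate
`∥𝓔f·𝓔g∥_{L^s} ≤ A ∥f∥_{L^r} ∥g∥_{L^r}` whenever `f, g` are supported in `1 × 1`
axis-parallel squares whose projections onto each coordinate axis are separated by a
distance between `1` and `4` (equivalently, the corners satisfy `2 ≤ |aᵢ - bᵢ| ≤ 5`). -/
def BH (s r A : ℝ) : Prop :=
  ∀ a₁ a₂ b₁ b₂ : ℝ, 2 ≤ |a₁ - b₁| → |a₁ - b₁| ≤ 5 → 2 ≤ |a₂ - b₂| → |a₂ - b₂| ≤ 5 →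
    ∀ f g : ℝ × ℝ → ℂ,
      Function.support f ⊆ unitSq a₁ a₂ → Function.support g ⊆ unitSq b₁ b₂ →
      eLpNorm (fun p => extOp f p * extOp g p) (ENNReal.ofReal s) volume ≤
        ENNReal.ofReal A * eLpNorm f (ENNReal.ofReal r) volume *
          eLpNorm g (ENNReal.ofReal r) volume


/-- The dyadic interval `[m·2⁻ⁿ, (m+1)·2⁻ⁿ]`. -/
def dyadicIcc (n m : ℤ) : Set ℝ := Icc ((m : ℝ) * 2 ^ (-n)) (((m : ℝ) + 1) * 2 ^ (-n))

/-- A tile in `𝓓_{j,k}`: a product of a dyadic interval of length `2⁻ʲ` with one of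
length `2⁻ᵏ`. -/
def tile (j k m m' : ℤ) : Set (ℝ × ℝ) := dyadicIcc j m ×ˢ dyadicIcc k m'

/-- A dyadic number is one of the form `2ⁿ`, `n ∈ ℤ`. -/
def IsDyadic (x : ℝ) : Prop := ∃ n : ℤ, x = 2 ^ n

open FourierTransform in
lemma kernel_exists : ∃ φ : ℝ → ℂ, ∃ K : ℝ, 0 < K ∧ Continuous φ ∧
    (∀ z, ‖φ z‖ ≤ K / (1 + (⌊z⌋ : ℝ) ^ 2)) ∧
    (∀ u : ℝ, 0 ≤ u → u ≤ 2 →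
      ∫ z : ℝ, Complex.exp (Complex.I * ((2 * Real.pi * z * u : ℝ) : ℂ)) * φ z = 1) := by
  let b : ContDiffBump (1 : ℝ) := ⟨1, 2, by norm_num, by norm_num⟩
  let bc : ℝ → ℂ := fun x => ((b x : ℝ) : ℂ)
  have h1 : HasCompactSupport bc := by
    exact b.hasCompactSupport.comp_left (g := fun x : ℝ => (x : ℂ)) (by simp)
  have h2 : ContDiff ℝ (⊤ : ℕ∞) bc := Complex.ofRealCLM.contDiff.comp b.contDiff
  let B : SchwartzMap ℝ ℂ := h1.toSchwartzMap h2
  let Φ : SchwartzMap ℝ ℂ := 𝓕 B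
  obtain ⟨C0, hC0, h0⟩ := Φ.decay 0 0
  obtain ⟨C2, hC2, h2'⟩ := Φ.decay 2 0
  refine ⟨Φ, 3 * (C0 + C2), by positivity, Φ.continuous, ?_, ?_⟩
  · intro z
    have e0 := h0 z
    have e2 := h2' z
    simp only [pow_zero, norm_iteratedFDeriv_zero, one_mul, Real.norm_eq_abs, sq_abs] at e0 e2
    rw [le_div_iff₀ (by positivity)]
    have hz1 := Int.floor_le z
    have hz2 := Int.lt_floor_add_one z
    have : (1 + (⌊z⌋ : ℝ) ^ 2) ≤ 3 * (1 + z ^ 2) := by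
      nlinarith [sq_nonneg (2 * z + (z - ⌊z⌋)), sq_nonneg (z + (z - ⌊z⌋))]
    have hn := norm_nonneg (Φ z)
    calc ‖Φ z‖ * (1 + (⌊z⌋ : ℝ) ^ 2) ≤ ‖Φ z‖ * (3 * (1 + z ^ 2)) := by gcongr
      _ ≤ _ := by nlinarith
  · intro u hu0 hu2
    have h3 : 𝓕⁻ Φ = B := FourierTransform.fourierInv_fourier_eq B
    have h4 : (𝓕⁻ (Φ : ℝ → ℂ)) u = B u := by
      rw [← h3, SchwartzMap.fourierInv_coe]
    rw [Real.fourierInv_eq'] at h4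
    have h5 : B u = 1 := by
      change ((b u : ℝ) : ℂ) = 1
      rw [b.one_of_mem_closedBall]
      · simp
      · simp only [Metric.mem_closedBall, Real.dist_eq, b]
        rw [abs_le]; constructor <;> linarith
    rw [h5] at h4
    rw [← h4]
    congr 1
    ext z
    simp only [smul_eq_mul]
    congr 2
    simp
    ring

noncomputable def vv (K : ℝ) (z : ℝ) : ℝ := K / (1 + (⌊z⌋ : ℝ) ^ 2)

lemma vv_nonneg {K : ℝ} (hK : 0 < K) (z : ℝ) : 0 ≤ vv K z := by unfold vv; positivity

lemma vv_meas (K : ℝ) : Measurable (vv K) := by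
  unfold vv
  have : Measurable fun z : ℝ => (⌊z⌋ : ℝ) := by
    exact (measurable_from_top (f := fun n : ℤ => (n : ℝ))).comp Int.measurable_floor
  fun_prop

lemma vv_int {K : ℝ} (hK : 0 < K) : Integrable (vv K) := by
  refine Integrable.mono' (integrable_inv_one_add_sq.const_mul (3 * K))
    (vv_meas K).aestronglyMeasurable (Filter.Eventually.of_forall fun z => ?_)
  rw [Real.norm_of_nonneg (vv_nonneg hK z)]
  unfold vv
  rw [← div_eq_mul_inv, div_le_div_iff₀ (by positivity) (by positivity)]
  have hz1 := Int.floor_le z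
  have hz2 := Int.lt_floor_add_one z
  have : (1 + z ^ 2) ≤ 3 * (1 + (⌊z⌋ : ℝ) ^ 2) := by
    nlinarith [sq_nonneg (⌊z⌋ - (z - ⌊z⌋))]
  nlinarith

lemma vv_orth {K : ℝ} (hK : 0 < K) (k : ℤ) (hk : k ≠ 0) :
    ∫ z : ℝ, Complex.exp (Complex.I * ((2 * Real.pi * z * k : ℝ) : ℂ)) * (vv K z : ℂ) = 0 := by
  have hintg : Integrable fun z : ℝ =>
      Complex.exp (Complex.I * ((2 * Real.pi * z * k : ℝ) : ℂ)) * (vv K z : ℂ) := by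
    refine Integrable.bdd_mul (c := 1) (vv_int hK).ofReal
      (by fun_prop) (Filter.Eventually.of_forall fun z => ?_)
    rw [mul_comm, Complex.norm_exp_ofReal_mul_I]
  rw [← setIntegral_univ, ← iUnion_Ico_intCast ℝ,
    integral_iUnion (fun n => measurableSet_Ico) (pairwise_disjoint_Ico_intCast ℝ)
      hintg.integrableOn]
  convert tsum_zero with n
  have : ∀ z ∈ Ico (n : ℝ) (n + 1),
      Complex.exp (Complex.I * ((2 * Real.pi * z * k : ℝ) : ℂ)) * (vv K z : ℂ)
      = Complex.exp ((2 * Real.pi * Complex.I * k) * z) * ((K / (1 + (n : ℝ) ^ 2) : ℝ) : ℂ) := by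
    intro z hz
    have : ⌊z⌋ = n := Int.floor_eq_iff.2 hz
    unfold vv
    rw [this]
    congr 2
    push_cast; ring
  rw [setIntegral_congr_fun measurableSet_Ico this, integral_mul_const,
    integral_Ico_eq_integral_Ioc, ← intervalIntegral.integral_of_le (by linarith),
    integral_exp_mul_complex (by simp [hk])]
  have e1 : Complex.exp ((2 * Real.pi * Complex.I * k) * ((n : ℝ) + 1 : ℝ)) = 1 := by
    rw [Complex.exp_eq_one_iff]; refine ⟨k * (n + 1), ?_⟩; push_cast; ring
  have e2 : Complex.exp ((2 * Real.pi * Complex.I * k) * ((n : ℝ))) = 1 := by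
    rw [Complex.exp_eq_one_iff]; refine ⟨k * n, ?_⟩; push_cast; ring
  rw [e1]
  push_cast at e2 ⊢
  rw [e2]; simp

noncomputable def ee (n : ℤ × ℤ) (y : ℝ × ℝ) : ℂ :=
  Complex.exp (Complex.I * ((2 * Real.pi * y.1 * (n.1 : ℝ) : ℝ) : ℂ)) *
    Complex.exp (Complex.I * ((2 * Real.pi * y.2 * (n.2 : ℝ) : ℝ) : ℂ))

lemma ee_cont (n : ℤ × ℤ) : Continuous (ee n) := by unfold ee; fun_prop

lemma ee_norm (n : ℤ × ℤ) (y : ℝ × ℝ) : ‖ee n y‖ = 1 := by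
  unfold ee
  rw [norm_mul, mul_comm Complex.I, Complex.norm_exp_ofReal_mul_I, mul_comm Complex.I,
    Complex.norm_exp_ofReal_mul_I, one_mul]

lemma ee_mul_conj (n m : ℤ × ℤ) (y : ℝ × ℝ) :
    ee n y * (starRingEnd ℂ) (ee m y) = ee (n - m) y := by
  unfold ee
  simp only [← Complex.exp_conj, ← Complex.exp_add]
  simp only [map_add, map_mul, Complex.conj_I, Complex.conj_ofReal]
  congr 1
  push_cast [Prod.fst_sub, Prod.snd_sub]
  ring

noncomputable def VV (K : ℝ) (y : ℝ × ℝ) : ℝ := vv K y.1 * vv K y.2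

lemma VV_nonneg {K : ℝ} (hK : 0 < K) (y : ℝ × ℝ) : 0 ≤ VV K y :=
  mul_nonneg (vv_nonneg hK _) (vv_nonneg hK _)

lemma VV_meas (K : ℝ) : Measurable (VV K) := by
  unfold VV
  exact ((vv_meas K).comp measurable_fst).mul ((vv_meas K).comp measurable_snd)

lemma VV_int {K : ℝ} (hK : 0 < K) : Integrable (VV K) := (vv_int hK).mul_prod (vv_int hK)

lemma VV_integral (K : ℝ) : ∫ y, VV K y = (∫ z, vv K z) ^ 2 := by
  unfold VV
  rw [sq]
  exact integral_prod_mul (vv K) (vv K)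

lemma VV_orth {K : ℝ} (hK : 0 < K) (n : ℤ × ℤ) (hn : n ≠ 0) :
    ∫ y, ee n y * (VV K y : ℂ) = 0 := by
  have : ∀ y : ℝ × ℝ, ee n y * (VV K y : ℂ) =
     (Complex.exp (Complex.I * ((2 * Real.pi * y.1 * (n.1 : ℝ) : ℝ) : ℂ)) * (vv K y.1 : ℂ)) *
     (Complex.exp (Complex.I * ((2 * Real.pi * y.2 * (n.2 : ℝ) : ℝ) : ℂ)) * (vv K y.2 : ℂ)) := by
    intro y; unfold ee VV; push_cast; ring
  simp_rw [this]
  have h := integral_prod_mul (μ := (volume : Measure ℝ)) (ν := (volume : Measure ℝ))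
    (fun z : ℝ => Complex.exp (Complex.I * ((2 * Real.pi * z * (n.1 : ℝ) : ℝ) : ℂ)) * (vv K z : ℂ))
    (fun z : ℝ => Complex.exp (Complex.I * ((2 * Real.pi * z * (n.2 : ℝ) : ℝ) : ℂ)) * (vv K z : ℂ))
  rw [Measure.volume_eq_prod, h]
  by_cases h1 : n.1 = 0
  · have h2 : n.2 ≠ 0 := fun h2 => hn (Prod.ext h1 h2)
    rw [vv_orth hK _ h2, mul_zero]
  · rw [vv_orth hK _ h1, zero_mul]

lemma ee_VV_int {K : ℝ} (hK : 0 < K) (n : ℤ × ℤ) :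
    Integrable fun y => ee n y * (VV K y : ℂ) := by
  refine Integrable.bdd_mul (c := 1) (VV_int hK).ofReal
      (ee_cont n).aestronglyMeasurable (Filter.Eventually.of_forall fun z => ?_)
  rw [ee_norm]

noncomputable def muV (K : ℝ) : Measure (ℝ × ℝ) :=
  volume.withDensity fun y => ENNReal.ofReal (VV K y)

noncomputable def BV (K : ℝ) : ℝ≥0∞ := ENNReal.ofReal ((∫ z, vv K z) ^ 2)

lemma muV_univ {K : ℝ} (hK : 0 < K) : muV K univ = BV K := by
  unfold muV BV
  rw [withDensity_apply _ MeasurableSet.univ, setLIntegral_univ, ← VV_integral,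
    ofReal_integral_eq_lintegral_ofReal (VV_int hK)
      (Filter.Eventually.of_forall fun y => VV_nonneg hK y)]

lemma BV_pos {K : ℝ} (hK : 0 < K) : BV K ≠ 0 := by
  unfold BV
  have : 0 < ∫ z, vv K z := by
    rw [integral_pos_iff_support_of_nonneg (fun z => vv_nonneg hK z) (vv_int hK)]
    have : Function.support (vv K) = univ := by
      ext z; simp only [Function.mem_support, mem_univ, iff_true]; unfold vv; positivity
    rw [this]; simp
  simp only [ne_eq, ENNReal.ofReal_eq_zero, not_le]; positivity

lemma BV_top (K : ℝ) : BV K ≠ ⊤ := ENNReal.ofReal_ne_top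

lemma trig_L2 {K : ℝ} (hK : 0 < K) {ι : Type*} (I : Finset ι) (n : ι → ℤ × ℤ)
    (hn : Set.InjOn n I) (c : ι → ℂ) :
    ∫⁻ y, ‖∑ i ∈ I, c i * ee (n i) y‖ₑ ^ (2 : ℝ) ∂(muV K) = BV K * ∑ i ∈ I, ‖c i‖ₑ ^ (2 : ℝ) := by
  have key : ∀ y, ((‖∑ i ∈ I, c i * ee (n i) y‖ ^ 2 * VV K y : ℝ) : ℂ) =
      ∑ i ∈ I, ∑ j ∈ I, (c i * (starRingEnd ℂ) (c j)) * (ee (n i - n j) y * (VV K y : ℂ)) := by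
    intro y
    push_cast
    rw [← Complex.mul_conj', map_sum, Finset.sum_mul_sum, Finset.sum_mul]
    refine Finset.sum_congr rfl fun i _ => ?_
    rw [Finset.sum_mul]
    refine Finset.sum_congr rfl fun j _ => ?_
    rw [← ee_mul_conj, map_mul]; ring
  have hI : ∫ y, (‖∑ i ∈ I, c i * ee (n i) y‖ ^ 2 * VV K y) =
      (∫ z, vv K z) ^ 2 * ∑ i ∈ I, ‖c i‖ ^ 2 := by
    have : ((∫ y, (‖∑ i ∈ I, c i * ee (n i) y‖ ^ 2 * VV K y) : ℝ) : ℂ) =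
      (((∫ z, vv K z) ^ 2 * ∑ i ∈ I, ‖c i‖ ^ 2 : ℝ) : ℂ) := by
      rw [← integral_complex_ofReal]
      simp_rw [key]
      rw [integral_finsetSum]
      · push_cast
        rw [Finset.mul_sum]
        refine Finset.sum_congr rfl fun i hi => ?_
        rw [integral_finsetSum]
        · rw [Finset.sum_eq_single i]
          · rw [integral_const_mul, Complex.mul_conj', sub_self]
            have : ∀ y, ee 0 y = 1 := by intro y; simp [ee]
            simp_rw [this, one_mul]
            rw [integral_complex_ofReal, VV_integral]; push_cast; ring
          · intro j hj hji
            rw [integral_const_mul, VV_orth hK, mul_zero]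
            intro h
            exact hji (hn hj hi (sub_eq_zero.1 h).symm)
          · intro h; exact absurd hi h
        · intro j _; exact (ee_VV_int hK _).const_mul _
      · intro i _
        exact integrable_finsetSum _ fun j _ => (ee_VV_int hK _).const_mul _
    exact_mod_cast this
  have hInt : Integrable fun y => (‖∑ i ∈ I, c i * ee (n i) y‖ ^ 2 * VV K y) := by
    have : Integrable fun y => ((‖∑ i ∈ I, c i * ee (n i) y‖ ^ 2 * VV K y : ℝ) : ℂ) := by
      simp_rw [key]
      exact integrable_finsetSum _ fun i _ => integrable_finsetSum _ fun j _ =>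
        (ee_VV_int hK _).const_mul _
    exact this.re
  have hc : Continuous fun y => ∑ i ∈ I, c i * ee (n i) y :=
    continuous_finsetSum _ fun i _ => continuous_const.mul (ee_cont _)
  unfold muV
  rw [lintegral_withDensity_eq_lintegral_mul _ (VV_meas K).ennreal_ofReal
    ((hc.enorm.measurable).pow_const _)]
  have e1 : ∀ y, ((fun y => ENNReal.ofReal (VV K y)) *
      fun y => ‖∑ i ∈ I, c i * ee (n i) y‖ₑ ^ (2 : ℝ)) y =
      ENNReal.ofReal (‖∑ i ∈ I, c i * ee (n i) y‖ ^ 2 * VV K y) := by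
    intro y
    rw [Pi.mul_apply, ENNReal.ofReal_mul (by positivity), ENNReal.ofReal_pow (norm_nonneg _),
      ofReal_norm, mul_comm]
    simp
  simp_rw [e1]
  rw [← ofReal_integral_eq_lintegral_ofReal hInt
    (Filter.Eventually.of_forall fun y => mul_nonneg (by positivity) (VV_nonneg hK y)), hI,
    ENNReal.ofReal_mul (by positivity), ENNReal.ofReal_sum_of_nonneg (fun i _ => by positivity)]
  unfold BV
  congr 1
  refine Finset.sum_congr rfl fun i _ => ?_
  rw [ENNReal.ofReal_pow (norm_nonneg _), ofReal_norm]; simp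

lemma sum_rpow_ge {ι : Type*} (I : Finset ι) (a : ι → ℝ≥0∞) {θ : ℝ} (h0 : 0 < θ) (h1 : θ ≤ 1) :
    (∑ i ∈ I, a i) ^ θ ≤ ∑ i ∈ I, a i ^ θ := by
  classical
  induction I using Finset.induction_on with
  | empty => simp [h0]
  | insert i I hi ih =>
    rw [Finset.sum_insert hi, Finset.sum_insert hi]
    exact (ENNReal.rpow_add_le_add_rpow _ _ h0.le h1).trans (by gcongr)

lemma trig_Lp {K : ℝ} (hK : 0 < K) {ι : Type*} (I : Finset ι) (n : ι → ℤ × ℤ)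
    (hn : Set.InjOn n I) (c : ι → ℂ) {s : ℝ} (hs1 : 1 ≤ s) (hs2 : s ≤ 2) :
    ∫⁻ y, ‖∑ i ∈ I, c i * ee (n i) y‖ₑ ^ s ∂(muV K) ≤ BV K * ∑ i ∈ I, ‖c i‖ₑ ^ s := by
  have hc : Continuous fun y => ∑ i ∈ I, c i * ee (n i) y :=
    continuous_finsetSum _ fun i _ => continuous_const.mul (ee_cont _)
  have h := eLpNorm'_le_eLpNorm'_mul_rpow_measure_univ (μ := muV K) (p := s) (q := 2)
    (by linarith) hs2 hc.aestronglyMeasurable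
  rw [eLpNorm', eLpNorm', trig_L2 hK I n hn c, muV_univ hK] at h
  have h' := ENNReal.rpow_le_rpow h (show 0 ≤ s by linarith)
  have hs : s ≠ 0 := by linarith
  rw [← ENNReal.rpow_mul, one_div_mul_cancel hs, ENNReal.rpow_one] at h'
  refine h'.trans ?_
  rw [ENNReal.mul_rpow_of_nonneg _ _ (by linarith), ENNReal.mul_rpow_of_nonneg _ _ (by norm_num),
    ENNReal.mul_rpow_of_nonneg _ _ (by linarith), ← ENNReal.rpow_mul, ← ENNReal.rpow_mul,
    ← ENNReal.rpow_mul, mul_right_comm, ← ENNReal.rpow_add _ _ (BV_pos hK) (BV_top K)]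
  have e : 1 / 2 * s + (1 / s - 1 / 2) * s = 1 := by field_simp; ring
  rw [e, ENNReal.rpow_one]
  gcongr
  refine (sum_rpow_ge I _ (by linarith) (by linarith)).trans (le_of_eq ?_)
  refine Finset.sum_congr rfl fun i _ => ?_
  rw [← ENNReal.rpow_mul]; congr 1; ring

/-- shift in the space variable -/
noncomputable def sh (P : ℝ × ℝ × ℝ) (y : ℝ × ℝ) : ℝ × ℝ × ℝ :=
  (P.1, P.2.1 + 2 * Real.pi * y.1, P.2.2 + 2 * Real.pi * y.2)

lemma sh_eq (P : ℝ × ℝ × ℝ) (y : ℝ × ℝ) :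
    sh P y = P + (0, 2 * Real.pi * y.1, 2 * Real.pi * y.2) := by
  unfold sh; ext <;> simp

lemma almost_orth {φ : ℝ → ℂ} {K : ℝ} (hK : 0 < K) (hφc : Continuous φ)
    (hφ : ∀ z, ‖φ z‖ ≤ vv K z) {ι : Type*} (I : Finset ι) (n : ι → ℤ × ℤ)
    (hn : Set.InjOn n I) (F : ι → ℝ × ℝ × ℝ → ℂ) (hFc : ∀ i ∈ I, Continuous (F i))
    (hFb : ∀ i ∈ I, ∃ M : ℝ, ∀ P, ‖F i P‖ ≤ M)
    (hF : ∀ i ∈ I, ∀ P, F i P = ∫ y : ℝ × ℝ, F i (sh P y) * ee (n i) y * (φ y.1 * φ y.2))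
    {s : ℝ} (hs1 : 1 ≤ s) (hs2 : s ≤ 2) :
    ∫⁻ P, ‖∑ i ∈ I, F i P‖ₑ ^ s ≤ BV K ^ s * ∑ i ∈ I, ∫⁻ P, ‖F i P‖ₑ ^ s := by
  have hshc : Continuous fun q : (ℝ × ℝ × ℝ) × (ℝ × ℝ) => sh q.1 q.2 := by unfold sh; fun_prop
  have hTc : Continuous fun q : (ℝ × ℝ × ℝ) × (ℝ × ℝ) =>
      ∑ i ∈ I, F i (sh q.1 q.2) * ee (n i) q.2 :=
    continuous_finsetSum _ fun i hi =>
      ((hFc i hi).comp hshc).mul ((ee_cont _).comp continuous_snd)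
  have hTc2 : Continuous fun q : (ℝ × ℝ × ℝ) × (ℝ × ℝ) =>
      ∑ i ∈ I, F i q.1 * ee (n i) q.2 :=
    continuous_finsetSum _ fun i hi =>
      ((hFc i hi).comp continuous_fst).mul ((ee_cont _).comp continuous_snd)
  have hφV : ∀ y : ℝ × ℝ, ‖φ y.1 * φ y.2‖ ≤ VV K y := fun y => by
    rw [norm_mul]; unfold VV
    exact mul_le_mul (hφ _) (hφ _) (norm_nonneg _) (vv_nonneg hK _)
  have hφφ : Integrable fun y : ℝ × ℝ => φ y.1 * φ y.2 :=
    Integrable.mono' (VV_int hK) (by fun_prop) (Filter.Eventually.of_forall hφV)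
  have hintg : ∀ i ∈ I, ∀ P,
      Integrable fun y : ℝ × ℝ => F i (sh P y) * ee (n i) y * (φ y.1 * φ y.2) := by
    intro i hi P
    obtain ⟨M, hM⟩ := hFb i hi
    refine Integrable.bdd_mul (c := M) hφφ ?_ (Filter.Eventually.of_forall fun y => ?_)
    · refine Continuous.aestronglyMeasurable (((hFc i hi).comp ?_).mul (ee_cont _))
      unfold sh; fun_prop
    · rw [norm_mul, ee_norm, mul_one]; exact hM _
  have step1 : ∀ P, ‖∑ i ∈ I, F i P‖ₑ ≤
      ∫⁻ y, ‖∑ i ∈ I, F i (sh P y) * ee (n i) y‖ₑ ∂(muV K) := by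
    intro P
    have e : ∑ i ∈ I, F i P =
        ∫ y : ℝ × ℝ, (∑ i ∈ I, F i (sh P y) * ee (n i) y) * (φ y.1 * φ y.2) := by
      rw [Finset.sum_congr rfl fun i hi => hF i hi P, ← integral_finsetSum _ fun i hi => hintg i hi P]
      simp_rw [Finset.sum_mul]
    rw [e]
    refine (enorm_integral_le_lintegral_enorm _).trans ?_
    unfold muV
    rw [lintegral_withDensity_eq_lintegral_mul _ (VV_meas K).ennreal_ofReal]
    · refine lintegral_mono fun y => ?_
      rw [enorm_mul, mul_comm, Pi.mul_apply]
      gcongr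
      rw [← ofReal_norm]
      exact ENNReal.ofReal_le_ofReal (hφV y)
    · exact (hTc.comp (by fun_prop : Continuous fun y : ℝ × ℝ => (P, y))).enorm.measurable
  have step2 : ∀ P, ‖∑ i ∈ I, F i P‖ₑ ^ s ≤
      BV K ^ (s - 1) * ∫⁻ y, ‖∑ i ∈ I, F i (sh P y) * ee (n i) y‖ₑ ^ s ∂(muV K) := by
    intro P
    have hc : Continuous fun y => ∑ i ∈ I, F i (sh P y) * ee (n i) y :=
      (hTc.comp (by fun_prop : Continuous fun y : ℝ × ℝ => (P, y)))
    have h := eLpNorm'_le_eLpNorm'_mul_rpow_measure_univ (μ := muV K) (p := 1) (q := s)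
      (by norm_num) hs1 hc.aestronglyMeasurable
    rw [eLpNorm', eLpNorm', muV_univ hK] at h
    simp only [ENNReal.rpow_one, div_one] at h
    have h' := ENNReal.rpow_le_rpow ((step1 P).trans h) (show 0 ≤ s by linarith)
    have hs : s ≠ 0 := by linarith
    refine h'.trans (le_of_eq ?_)
    rw [ENNReal.mul_rpow_of_nonneg _ _ (by linarith), ← ENNReal.rpow_mul, ← ENNReal.rpow_mul,
      one_div_mul_cancel hs, ENNReal.rpow_one, mul_comm]
    congr 2
    field_simp
  have i2 : (volume : Measure (ℝ × ℝ)).IsAddHaarMeasure :=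
    inferInstanceAs ((volume : Measure ℝ).prod (volume : Measure ℝ)).IsAddHaarMeasure
  have i3 : (volume : Measure (ℝ × ℝ × ℝ)).IsAddHaarMeasure :=
    inferInstanceAs ((volume : Measure ℝ).prod (volume : Measure (ℝ × ℝ))).IsAddHaarMeasure
  have : SFinite (muV K) := by unfold muV; infer_instance
  calc ∫⁻ P, ‖∑ i ∈ I, F i P‖ₑ ^ s
      ≤ ∫⁻ P, BV K ^ (s - 1) * ∫⁻ y, ‖∑ i ∈ I, F i (sh P y) * ee (n i) y‖ₑ ^ s ∂(muV K) :=
        lintegral_mono step2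
    _ = BV K ^ (s - 1) * ∫⁻ P, ∫⁻ y, ‖∑ i ∈ I, F i (sh P y) * ee (n i) y‖ₑ ^ s ∂(muV K) :=
        lintegral_const_mul' _ _ (ENNReal.rpow_ne_top_of_nonneg (by linarith) (BV_top K))
    _ = BV K ^ (s - 1) * ∫⁻ y, ∫⁻ P, ‖∑ i ∈ I, F i (sh P y) * ee (n i) y‖ₑ ^ s ∂volume ∂(muV K) := by
        rw [lintegral_lintegral_swap]
        exact (hTc.enorm.measurable.pow_const _).aemeasurable
    _ = BV K ^ (s - 1) * ∫⁻ y, ∫⁻ P, ‖∑ i ∈ I, F i P * ee (n i) y‖ₑ ^ s ∂volume ∂(muV K) := by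
        congr 1
        refine lintegral_congr fun y => ?_
        simp_rw [sh_eq, add_comm _ ((0 : ℝ), 2 * Real.pi * y.1, 2 * Real.pi * y.2)]
        exact lintegral_add_left_eq_self (fun P => ‖∑ i ∈ I, F i P * ee (n i) y‖ₑ ^ s) _
    _ = BV K ^ (s - 1) * ∫⁻ P, ∫⁻ y, ‖∑ i ∈ I, F i P * ee (n i) y‖ₑ ^ s ∂(muV K) := by
        rw [lintegral_lintegral_swap]
        exact ((hTc2.comp continuous_swap).enorm.measurable.pow_const _).aemeasurable
    _ ≤ BV K ^ (s - 1) * ∫⁻ P, BV K * ∑ i ∈ I, ‖F i P‖ₑ ^ s := by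
        gcongr with P
        exact trig_Lp hK I n hn (fun i => F i P) hs1 hs2
    _ = _ := by
        rw [lintegral_const_mul' _ _ (BV_top K), lintegral_finsetSum', ← mul_assoc]
        · congr 1
          conv_lhs => rw [← ENNReal.rpow_one (BV K), ← ENNReal.rpow_mul,
            ← ENNReal.rpow_add _ _ (BV_pos hK) (BV_top K)]
          congr 1; ring
        · intro i hi
          exact ((hFc i hi).enorm.measurable.pow_const _).aemeasurable

noncomputable def ph (p : ℝ × ℝ × ℝ) (ξ : ℝ × ℝ) : ℂ :=
  Complex.exp (Complex.I * (p.1 * ξ.1 * ξ.2 + p.2.1 * ξ.1 + p.2.2 * ξ.2 : ℝ))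

lemma extOp_eq (f : ℝ × ℝ → ℂ) (p : ℝ × ℝ × ℝ) : extOp f p = ∫ ξ, ph p ξ * f ξ := rfl

lemma norm_ph (p : ℝ × ℝ × ℝ) (ξ : ℝ × ℝ) : ‖ph p ξ‖ = 1 := by
  unfold ph
  rw [mul_comm, Complex.norm_exp_ofReal_mul_I]

lemma ph_cont : Continuous fun q : (ℝ × ℝ × ℝ) × (ℝ × ℝ) => ph q.1 q.2 := by
  unfold ph; fun_prop

lemma ph_cont2 (p : ℝ × ℝ × ℝ) : Continuous (ph p) := by
  unfold ph; fun_prop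

lemma ph_int {f : ℝ × ℝ → ℂ} (hf : Integrable f) (p : ℝ × ℝ × ℝ) :
    Integrable fun ξ => ph p ξ * f ξ :=
  Integrable.bdd_mul (c := 1) hf (ph_cont2 p).aestronglyMeasurable
    (Filter.Eventually.of_forall fun ξ => (norm_ph p ξ).le)

lemma extOp_cont {f : ℝ × ℝ → ℂ} (hf : Integrable f) : Continuous (extOp f) := by
  refine continuous_of_dominated (bound := fun ξ => ‖f ξ‖) (fun p => ?_) (fun p => ?_) hf.norm ?_
  · exact (ph_int hf p).aestronglyMeasurable
  · refine Filter.Eventually.of_forall fun ξ => ?_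
    have := norm_ph p ξ
    unfold ph at this
    rw [norm_mul, this, one_mul]
  · refine Filter.Eventually.of_forall fun ξ => ?_
    fun_prop

lemma extOp_bdd (f : ℝ × ℝ → ℂ) (p : ℝ × ℝ × ℝ) : ‖extOp f p‖ ≤ ∫ ξ, ‖f ξ‖ := by
  rw [extOp_eq]
  refine (norm_integral_le_integral_norm _).trans (le_of_eq ?_)
  simp_rw [norm_mul, norm_ph, one_mul]

lemma extOp_mul (f g : ℝ × ℝ → ℂ) (p : ℝ × ℝ × ℝ) :
    extOp f p * extOp g p =
      ∫ q : (ℝ × ℝ) × (ℝ × ℝ), (ph p q.1 * ph p q.2) * (f q.1 * g q.2) := by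
  rw [extOp_eq, extOp_eq, ← integral_prod_mul]
  rw [← Measure.volume_eq_prod]
  congr 1; ext q; ring

lemma ph_sh (p : ℝ × ℝ × ℝ) (y ξ : ℝ × ℝ) :
    ph (sh p y) ξ = ph p ξ *
      (Complex.exp (Complex.I * ((2 * Real.pi * y.1 * ξ.1 : ℝ) : ℂ)) *
       Complex.exp (Complex.I * ((2 * Real.pi * y.2 * ξ.2 : ℝ) : ℂ))) := by
  unfold ph sh
  simp only [← Complex.exp_add]
  congr 1; push_cast; ring

lemma int_aux {X Y : Type*} [MeasurableSpace X] [MeasurableSpace Y] {μ : Measure X}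
    {ν : Measure Y} [SFinite μ] [SFinite ν] {u : X → ℂ} {w : Y → ℂ} (hu : Integrable u μ)
    (hw : Integrable w ν) (k : X × Y → ℂ) (hk : AEStronglyMeasurable k (μ.prod ν))
    (hk1 : ∀ z, ‖k z‖ ≤ 1) :
    Integrable (fun z : X × Y => k z * (u z.1 * w z.2)) (μ.prod ν) :=
  Integrable.bdd_mul (c := 1) (hu.mul_prod hw) hk (Filter.Eventually.of_forall hk1)

lemma repro {φ : ℝ → ℂ} {K : ℝ} (hK : 0 < K) (hφc : Continuous φ)
    (hφ : ∀ z, ‖φ z‖ ≤ vv K z)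
    (hφ1 : ∀ u : ℝ, 0 ≤ u → u ≤ 2 →
      ∫ z : ℝ, Complex.exp (Complex.I * ((2 * Real.pi * z * u : ℝ) : ℂ)) * φ z = 1)
    {f g : ℝ × ℝ → ℂ} (hf : Integrable f) (hg : Integrable g) (a b : ℤ × ℤ)
    (hfs : Function.support f ⊆ unitSq a.1 a.2) (hgs : Function.support g ⊆ unitSq b.1 b.2)
    (P : ℝ × ℝ × ℝ) :
    extOp f P * extOp g P =
      ∫ y : ℝ × ℝ, (extOp f (sh P y) * extOp g (sh P y)) * ee (-(a + b)) y * (φ y.1 * φ y.2) := by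
  have hφV : ∀ y : ℝ × ℝ, ‖φ y.1 * φ y.2‖ ≤ VV K y := fun y => by
    rw [norm_mul]; unfold VV
    exact mul_le_mul (hφ _) (hφ _) (norm_nonneg _) (vv_nonneg hK _)
  have hφφ : Integrable fun y : ℝ × ℝ => φ y.1 * φ y.2 :=
    Integrable.mono' (VV_int hK) (by fun_prop) (Filter.Eventually.of_forall hφV)
  have hfg : Integrable fun q : (ℝ × ℝ) × (ℝ × ℝ) => f q.1 * g q.2 := hf.mul_prod hg
  have hshc : Continuous fun y : ℝ × ℝ => sh P y := by unfold sh; fun_prop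
  have hbig : Integrable (Function.uncurry fun (y : ℝ × ℝ) (q : (ℝ × ℝ) × (ℝ × ℝ)) =>
      (ph (sh P y) q.1 * ph (sh P y) q.2 * ee (-(a + b)) y) *
        ((φ y.1 * φ y.2) * (f q.1 * g q.2)))
      ((volume : Measure (ℝ × ℝ)).prod (volume : Measure ((ℝ × ℝ) × (ℝ × ℝ)))) := by
    have c1 : Continuous fun z : (ℝ × ℝ) × ((ℝ × ℝ) × (ℝ × ℝ)) => ph (sh P z.1) z.2.1 := by
      unfold ph sh; fun_prop
    have c2 : Continuous fun z : (ℝ × ℝ) × ((ℝ × ℝ) × (ℝ × ℝ)) => ph (sh P z.1) z.2.2 := by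
      unfold ph sh; fun_prop
    have c3 : Continuous fun z : (ℝ × ℝ) × ((ℝ × ℝ) × (ℝ × ℝ)) => ee (-(a + b)) z.1 :=
      (ee_cont _).comp continuous_fst
    have c4 := ((c1.mul c2).mul c3)
    have hk1 : ∀ z : (ℝ × ℝ) × ((ℝ × ℝ) × (ℝ × ℝ)),
        ‖ph (sh P z.1) z.2.1 * ph (sh P z.1) z.2.2 * ee (-(a + b)) z.1‖ ≤ 1 := by
      intro z
      rw [norm_mul, norm_mul, norm_ph, norm_ph, ee_norm]; norm_num
    exact int_aux hφφ hfg _ c4.aestronglyMeasurable hk1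
  have e1 : ∀ y : ℝ × ℝ,
      (extOp f (sh P y) * extOp g (sh P y)) * ee (-(a + b)) y * (φ y.1 * φ y.2) =
      ∫ q : (ℝ × ℝ) × (ℝ × ℝ), (ph (sh P y) q.1 * ph (sh P y) q.2 * ee (-(a + b)) y) *
        ((φ y.1 * φ y.2) * (f q.1 * g q.2)) := by
    intro y
    rw [extOp_mul, mul_assoc, ← integral_mul_const]
    congr 1; ext q; ring
  simp_rw [e1]
  rw [integral_integral_swap hbig, extOp_mul]
  congr 1; ext q
  by_cases hq : f q.1 * g q.2 = 0
  · simp [hq]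
  have hq1 : q.1 ∈ unitSq a.1 a.2 := hfs (left_ne_zero_of_mul hq)
  have hq2 : q.2 ∈ unitSq b.1 b.2 := hgs (right_ne_zero_of_mul hq)
  simp only [unitSq, mem_prod, mem_Icc] at hq1 hq2
  obtain ⟨⟨h1, h2⟩, h3, h4⟩ := hq1
  obtain ⟨⟨h5, h6⟩, h7, h8⟩ := hq2
  have e2 : ∀ y : ℝ × ℝ, (ph (sh P y) q.1 * ph (sh P y) q.2 * ee (-(a + b)) y) *
        ((φ y.1 * φ y.2) * (f q.1 * g q.2)) =
      (ph P q.1 * ph P q.2 * (f q.1 * g q.2)) *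
      ((Complex.exp (Complex.I *
          ((2 * Real.pi * y.1 * (q.1.1 + q.2.1 - (a.1 + b.1)) : ℝ) : ℂ)) * φ y.1) *
       (Complex.exp (Complex.I *
          ((2 * Real.pi * y.2 * (q.1.2 + q.2.2 - (a.2 + b.2)) : ℝ) : ℂ)) * φ y.2)) := by
    intro y
    have h9 : Complex.exp (Complex.I *
          ((2 * Real.pi * y.1 * (q.1.1 + q.2.1 - (a.1 + b.1)) : ℝ) : ℂ)) *
       Complex.exp (Complex.I *
          ((2 * Real.pi * y.2 * (q.1.2 + q.2.2 - (a.2 + b.2)) : ℝ) : ℂ)) =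
       (Complex.exp (Complex.I * ((2 * Real.pi * y.1 * q.1.1 : ℝ) : ℂ)) *
       Complex.exp (Complex.I * ((2 * Real.pi * y.2 * q.1.2 : ℝ) : ℂ))) *
       (Complex.exp (Complex.I * ((2 * Real.pi * y.1 * q.2.1 : ℝ) : ℂ)) *
       Complex.exp (Complex.I * ((2 * Real.pi * y.2 * q.2.2 : ℝ) : ℂ))) * ee (-(a + b)) y := by
      unfold ee
      simp only [← Complex.exp_add]
      congr 1
      push_cast [Prod.fst_neg, Prod.snd_neg, Prod.fst_add, Prod.snd_add]; ring
    rw [ph_sh, ph_sh]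
    calc _ = (ph P q.1 * ph P q.2 * (f q.1 * g q.2)) * (((Complex.exp (Complex.I * ((2 * Real.pi * y.1 * q.1.1 : ℝ) : ℂ)) *
       Complex.exp (Complex.I * ((2 * Real.pi * y.2 * q.1.2 : ℝ) : ℂ))) *
       (Complex.exp (Complex.I * ((2 * Real.pi * y.1 * q.2.1 : ℝ) : ℂ)) *
       Complex.exp (Complex.I * ((2 * Real.pi * y.2 * q.2.2 : ℝ) : ℂ))) * ee (-(a + b)) y) * (φ y.1 * φ y.2)) := by ring
      _ = _ := by rw [← h9]; ring
  simp_rw [e2]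
  rw [integral_const_mul]
  have h10 := integral_prod_mul (μ := (volume : Measure ℝ)) (ν := (volume : Measure ℝ))
    (fun z : ℝ => Complex.exp (Complex.I *
          ((2 * Real.pi * z * (q.1.1 + q.2.1 - (a.1 + b.1)) : ℝ) : ℂ)) * φ z)
    (fun z : ℝ => Complex.exp (Complex.I *
          ((2 * Real.pi * z * (q.1.2 + q.2.2 - (a.2 + b.2)) : ℝ) : ℂ)) * φ z)
  rw [Measure.volume_eq_prod, h10, hφ1 _ (by linarith) (by linarith),
    hφ1 _ (by linarith) (by linarith)]
  ring

/-- half-open unit squares -/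
def QQ (m : ℤ × ℤ) : Set (ℝ × ℝ) := {u | ⌊u.1⌋ = m.1 ∧ ⌊u.2⌋ = m.2}

lemma QQ_meas (m : ℤ × ℤ) : MeasurableSet (QQ m) := by
  have h1 : MeasurableSet {u : ℝ × ℝ | ⌊u.1⌋ = m.1} :=
    (Int.measurable_floor.comp measurable_fst) (measurableSet_singleton m.1)
  have h2 : MeasurableSet {u : ℝ × ℝ | ⌊u.2⌋ = m.2} :=
    (Int.measurable_floor.comp measurable_snd) (measurableSet_singleton m.2)
  exact h1.inter h2

lemma QQ_sub (m : ℤ × ℤ) : QQ m ⊆ unitSq m.1 m.2 := by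
  rintro u ⟨h1, h2⟩
  rw [Int.floor_eq_iff] at h1 h2
  exact ⟨⟨h1.1, h1.2.le⟩, ⟨h2.1, h2.2.le⟩⟩

lemma QQ_disj {m n : ℤ × ℤ} (h : m ≠ n) : Disjoint (QQ m) (QQ n) := by
  rw [Set.disjoint_left]
  rintro u ⟨h1, h2⟩ ⟨h3, h4⟩
  exact h (Prod.ext (h1.symm.trans h3) (h2.symm.trans h4))

lemma chi_int {Ω : Set (ℝ × ℝ)} (hΩ : MeasurableSet Ω) (hfin : volume Ω ≠ ⊤) :
    Integrable (chi Ω) := by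
  unfold chi
  rw [integrable_indicator_iff hΩ]
  exact integrableOn_const hfin

lemma chi_supp (Ω : Set (ℝ × ℝ)) : Function.support (chi Ω) ⊆ Ω := by
  unfold chi; exact Set.support_indicator_subset

lemma sum_QQ_le {Ω : Set (ℝ × ℝ)} (hΩ : MeasurableSet Ω) (I : Finset (ℤ × ℤ)) (d : ℤ × ℤ) :
    ∑ m ∈ I, volume (Ω ∩ QQ (m + d)) ≤ volume Ω := by
  rw [← measure_biUnion_finset]
  · exact measure_mono (iUnion₂_subset fun m _ => inter_subset_left)
  · intro m _ n _ hmn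
    refine (QQ_disj (m := m + d) (n := n + d) ?_).mono inter_subset_right inter_subset_right
    intro h; exact hmn (add_right_cancel h)
  · intro m _; exact hΩ.inter (QQ_meas _)

def DD : Finset (ℤ × ℤ) := ({-3, -2, 2, 3} : Finset ℤ) ×ˢ ({-3, -2, 2, 3} : Finset ℤ)

lemma DD_abs {d : ℤ × ℤ} (hd : d ∈ DD) :
    2 ≤ |(d.1 : ℝ)| ∧ |(d.1 : ℝ)| ≤ 5 ∧ 2 ≤ |(d.2 : ℝ)| ∧ |(d.2 : ℝ)| ≤ 5 := by
  simp only [DD, Finset.mem_product, Finset.mem_insert, Finset.mem_singleton] at hd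
  obtain ⟨h1, h2⟩ := hd
  have key : ∀ x : ℤ, (x = -3 ∨ x = -2 ∨ x = 2 ∨ x = 3) → 2 ≤ |(x : ℝ)| ∧ |(x : ℝ)| ≤ 5 := by
    rintro x (rfl | rfl | rfl | rfl) <;> norm_num
  exact ⟨(key _ h1).1, (key _ h1).2, (key _ h2).1, (key _ h2).2⟩

lemma ab_bound {a b M : ℝ≥0∞} (ha : a ≤ M) (hb : b ≤ M) {x : ℝ} (hx : 0 < x)
    (hx2 : 0 ≤ 2 * x - 1) : a ^ x * b ^ x ≤ M ^ (2 * x - 1) * (a + b) := by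
  have hc : max a b ≤ M := max_le ha hb
  calc a ^ x * b ^ x ≤ (max a b) ^ x * (max a b) ^ x := by
        gcongr
        · exact le_max_left _ _
        · exact le_max_right _ _
    _ = (max a b) ^ (2 * x - 1) * (max a b) := by
        rw [← ENNReal.rpow_add_of_nonneg _ _ hx.le hx.le]
        conv_rhs => rw [← ENNReal.rpow_one (max a b), ← ENNReal.rpow_mul,
          ← ENNReal.rpow_add_of_nonneg _ _ (by linarith) (by norm_num)]
        congr 1; ring
    _ ≤ M ^ (2 * x - 1) * (a + b) := by
        gcongr
        exact max_le le_self_add le_add_self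

lemma chi_eLpNorm {Ω : Set (ℝ × ℝ)} (hΩ : MeasurableSet Ω) {r : ℝ} (hr : 0 < r) :
    eLpNorm (chi Ω) (ENNReal.ofReal r) volume = volume Ω ^ (1 / r) := by
  unfold chi
  rw [eLpNorm_indicator_const hΩ (by simpa using hr) ENNReal.ofReal_ne_top,
    ENNReal.toReal_ofReal hr.le]
  simp

lemma pair_bound {s r A : ℝ} (hs : 0 < s) (hr : 0 < r) (hsr : 0 ≤ 2 * (s / r) - 1)
    (hBH : BH s r A) {Ω : Set (ℝ × ℝ)} (hΩ : MeasurableSet Ω) {M : ℝ≥0∞}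
    (hM : ∀ m, volume (Ω ∩ QQ m) ≤ M) (m d : ℤ × ℤ) (hd : d ∈ DD) :
    ∫⁻ P, ‖extOp (chi (Ω ∩ QQ m)) P * extOp (chi (Ω ∩ QQ (m + d))) P‖ₑ ^ s ≤
      ENNReal.ofReal A ^ s * (M ^ (2 * (s / r) - 1) *
        (volume (Ω ∩ QQ m) + volume (Ω ∩ QQ (m + d)))) := by
  obtain ⟨d1, d2, d3, d4⟩ := DD_abs hd
  have e1 : ((m + d).1 : ℝ) = m.1 + d.1 := by push_cast [Prod.fst_add]; rfl
  have e2 : ((m + d).2 : ℝ) = m.2 + d.2 := by push_cast [Prod.snd_add]; rfl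
  have h := hBH m.1 m.2 (m + d).1 (m + d).2
    (by rw [e1]; simpa using d1) (by rw [e1]; simpa using d2)
    (by rw [e2]; simpa using d3) (by rw [e2]; simpa using d4)
    (chi (Ω ∩ QQ m)) (chi (Ω ∩ QQ (m + d)))
    ((chi_supp _).trans (inter_subset_right.trans (QQ_sub _)))
    ((chi_supp _).trans (inter_subset_right.trans (QQ_sub _)))
  rw [chi_eLpNorm (hΩ.inter (QQ_meas _)) hr, chi_eLpNorm (hΩ.inter (QQ_meas _)) hr,
    eLpNorm_eq_lintegral_rpow_enorm_toReal (by simpa using hs) ENNReal.ofReal_ne_top,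
    ENNReal.toReal_ofReal hs.le] at h
  have h' := ENNReal.rpow_le_rpow h hs.le
  rw [← ENNReal.rpow_mul, one_div_mul_cancel hs.ne', ENNReal.rpow_one] at h'
  refine h'.trans ?_
  rw [ENNReal.mul_rpow_of_nonneg _ _ hs.le, ENNReal.mul_rpow_of_nonneg _ _ hs.le,
    ← ENNReal.rpow_mul, ← ENNReal.rpow_mul, mul_assoc]
  refine mul_le_mul_right ?_ _
  have e3 : 1 / r * s = s / r := by ring
  rw [e3]
  exact ab_bound (hM _) (hM _) (by positivity) hsr

lemma diag_bound {s r A : ℝ} (hs : 1 ≤ s) (hs2 : s ≤ 2) (hr : 0 < r)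
    (hsr : 0 ≤ 2 * (s / r) - 1)
    (hBH : BH s r A) {φ : ℝ → ℂ} {K : ℝ} (hK : 0 < K) (hφc : Continuous φ)
    (hφ : ∀ z, ‖φ z‖ ≤ vv K z)
    (hφ1 : ∀ u : ℝ, 0 ≤ u → u ≤ 2 →
      ∫ z : ℝ, Complex.exp (Complex.I * ((2 * Real.pi * z * u : ℝ) : ℂ)) * φ z = 1)
    {Ω : Set (ℝ × ℝ)} (hΩ : MeasurableSet Ω) (hfin : volume Ω ≠ ⊤) {M : ℝ≥0∞}
    (hM : ∀ m, volume (Ω ∩ QQ m) ≤ M) (I : Finset (ℤ × ℤ)) (d : ℤ × ℤ) (hd : d ∈ DD) :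
    ∫⁻ P, ‖∑ m ∈ I, extOp (chi (Ω ∩ QQ m)) P * extOp (chi (Ω ∩ QQ (m + d))) P‖ₑ ^ s ≤
      BV K ^ s * (ENNReal.ofReal A ^ s * (M ^ (2 * (s / r) - 1) * (2 * volume Ω))) := by
  have hintg : ∀ m, Integrable (chi (Ω ∩ QQ m)) := fun m =>
    chi_int (hΩ.inter (QQ_meas _)) (ne_top_of_le_ne_top hfin (measure_mono inter_subset_left))
  have h := almost_orth hK hφc hφ I (fun m => -(m + (m + d)))
    (by
      intro m _ n _ hmn
      have h1 := congrArg Prod.fst hmn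
      have h2 := congrArg Prod.snd hmn
      simp only [Prod.fst_neg, Prod.snd_neg, Prod.fst_add, Prod.snd_add] at h1 h2
      exact Prod.ext (by omega) (by omega))
    (fun m P => extOp (chi (Ω ∩ QQ m)) P * extOp (chi (Ω ∩ QQ (m + d))) P)
    (fun m _ => (extOp_cont (hintg _)).mul (extOp_cont (hintg _)))
    (fun m _ => ⟨(∫ ξ, ‖chi (Ω ∩ QQ m) ξ‖) * (∫ ξ, ‖chi (Ω ∩ QQ (m + d)) ξ‖), fun P => by
      rw [norm_mul]
      exact mul_le_mul (extOp_bdd _ _) (extOp_bdd _ _) (norm_nonneg _)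
        (integral_nonneg fun _ => norm_nonneg _)⟩)
    (fun m _ P => repro hK hφc hφ hφ1 (hintg _) (hintg _) m (m + d)
      ((chi_supp _).trans (inter_subset_right.trans (QQ_sub _)))
      ((chi_supp _).trans (inter_subset_right.trans (QQ_sub _))) P) hs hs2
  refine h.trans ?_
  gcongr
  refine (Finset.sum_le_sum fun m _ =>
    pair_bound (by linarith) hr hsr hBH hΩ hM m d hd).trans ?_
  rw [← Finset.mul_sum, ← Finset.mul_sum, Finset.sum_add_distrib]
  gcongr
  rw [two_mul]
  exact add_le_add (by simpa using sum_QQ_le hΩ I 0) (sum_QQ_le hΩ I d)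

lemma unit_bound {s r A : ℝ} (hs : 1 ≤ s) (hs2 : s ≤ 2) (hr : 0 < r)
    (hsr : 0 ≤ 2 * (s / r) - 1)
    (hBH : BH s r A) {φ : ℝ → ℂ} {K : ℝ} (hK : 0 < K) (hφc : Continuous φ)
    (hφ : ∀ z, ‖φ z‖ ≤ vv K z)
    (hφ1 : ∀ u : ℝ, 0 ≤ u → u ≤ 2 →
      ∫ z : ℝ, Complex.exp (Complex.I * ((2 * Real.pi * z * u : ℝ) : ℂ)) * φ z = 1)
    {Ω : Set (ℝ × ℝ)} (hΩ : MeasurableSet Ω) (hfin : volume Ω ≠ ⊤) {M : ℝ≥0∞}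
    (hM : ∀ m, volume (Ω ∩ QQ m) ≤ M) (I : ℤ × ℤ → Finset (ℤ × ℤ)) :
    eLpNorm' (fun P => ∑ d ∈ DD, ∑ m ∈ I d,
        extOp (chi (Ω ∩ QQ m)) P * extOp (chi (Ω ∩ QQ (m + d))) P) s volume ≤
      16 * (BV K * (ENNReal.ofReal A * (M ^ (2 / r - 1 / s) * (2 * volume Ω) ^ (1 / s)))) := by
  have hintg : ∀ m, Integrable (chi (Ω ∩ QQ m)) := fun m =>
    chi_int (hΩ.inter (QQ_meas _)) (ne_top_of_le_ne_top hfin (measure_mono inter_subset_left))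
  have hs0 : s ≠ 0 := by linarith
  have hsp : 0 < s := by linarith
  have h := eLpNorm'_sum_le (μ := (volume : Measure (ℝ × ℝ × ℝ))) (q := s) (s := DD)
    (f := fun d P => ∑ m ∈ I d,
        extOp (chi (Ω ∩ QQ m)) P * extOp (chi (Ω ∩ QQ (m + d))) P)
    (fun d _ => Continuous.aestronglyMeasurable (continuous_finsetSum _ fun m _ =>
      (extOp_cont (hintg _)).mul (extOp_cont (hintg _)))) hs
  have e : (fun P => ∑ d ∈ DD, ∑ m ∈ I d,
        extOp (chi (Ω ∩ QQ m)) P * extOp (chi (Ω ∩ QQ (m + d))) P) =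
      ∑ d ∈ DD, fun P => ∑ m ∈ I d,
        extOp (chi (Ω ∩ QQ m)) P * extOp (chi (Ω ∩ QQ (m + d))) P := by
    ext P; rw [Finset.sum_apply]
  rw [e]
  refine h.trans ?_
  have h2 : ∀ d ∈ DD, eLpNorm' (fun P => ∑ m ∈ I d,
        extOp (chi (Ω ∩ QQ m)) P * extOp (chi (Ω ∩ QQ (m + d))) P) s volume ≤
      BV K * (ENNReal.ofReal A * (M ^ (2 / r - 1 / s) * (2 * volume Ω) ^ (1 / s))) := by
    intro d hd
    have h3 := ENNReal.rpow_le_rpow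
      (diag_bound hs hs2 hr hsr hBH hK hφc hφ hφ1 hΩ hfin hM (I d) d hd)
      (show 0 ≤ 1 / s by positivity)
    refine h3.trans (le_of_eq ?_)
    rw [ENNReal.mul_rpow_of_nonneg _ _ (by positivity),
      ENNReal.mul_rpow_of_nonneg _ _ (by positivity),
      ENNReal.mul_rpow_of_nonneg _ _ (by positivity), ← ENNReal.rpow_mul, ← ENNReal.rpow_mul,
      ← ENNReal.rpow_mul, mul_one_div_cancel hs0, ENNReal.rpow_one, ENNReal.rpow_one]
    congr 4
    field_simp
  refine (Finset.sum_le_sum h2).trans (le_of_eq ?_)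
  rw [Finset.sum_const, nsmul_eq_mul]
  have : DD.card = 16 := by decide
  rw [this]; norm_num

def dil (a b : ℝ) (ξ : ℝ × ℝ) : ℝ × ℝ := (a * ξ.1, b * ξ.2)

lemma dil_map {a b : ℝ} (ha : 0 < a) (hb : 0 < b) :
    Measure.map (dil a b) volume = ENNReal.ofReal ((a * b)⁻¹) • volume := by
  have h := Measure.map_prod_map (volume : Measure ℝ) (volume : Measure ℝ)
    (measurable_const_mul a) (measurable_const_mul b)
  rw [Real.map_volume_mul_left ha.ne', Real.map_volume_mul_left hb.ne', abs_of_pos (by positivity),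
    abs_of_pos (by positivity), Measure.prod_smul_left, Measure.prod_smul_right, smul_smul,
    ← ENNReal.ofReal_mul (by positivity), ← mul_inv, ← Measure.volume_eq_prod] at h
  rw [h]; rfl

lemma dil_emb {a b : ℝ} (ha : 0 < a) (hb : 0 < b) : MeasurableEmbedding (dil a b) :=
  ((Homeomorph.mulLeft₀ a ha.ne').prodCongr (Homeomorph.mulLeft₀ b hb.ne')).measurableEmbedding

lemma dil_integral {a b : ℝ} (ha : 0 < a) (hb : 0 < b) (g : ℝ × ℝ → ℂ) :
    ∫ ξ, g (dil a b ξ) = ((a * b)⁻¹ : ℝ) * ∫ u, g u := by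
  rw [← (dil_emb ha hb).integral_map, dil_map ha hb, integral_smul_measure,
    ENNReal.toReal_ofReal (by positivity)]
  rfl

noncomputable def dil3 (a b : ℝ) (P : ℝ × ℝ × ℝ) : ℝ × ℝ × ℝ := ((a * b)⁻¹ * P.1, dil a⁻¹ b⁻¹ P.2)

lemma dil3_map {a b : ℝ} (ha : 0 < a) (hb : 0 < b) :
    Measure.map (dil3 a b) volume = ENNReal.ofReal ((a * b) ^ 2) • volume := by
  have h := Measure.map_prod_map (volume : Measure ℝ) (volume : Measure (ℝ × ℝ))
    (measurable_const_mul (a * b)⁻¹)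
    (dil_emb (a := a⁻¹) (b := b⁻¹) (by positivity) (by positivity)).measurable
  have hab : 0 < a * b := by positivity
  rw [Real.map_volume_mul_left (by positivity), dil_map (by positivity) (by positivity),
    abs_of_pos (by positivity), Measure.prod_smul_left, Measure.prod_smul_right, smul_smul,
    ← ENNReal.ofReal_mul (by positivity), ← Measure.volume_eq_prod] at h
  have e : (a * b)⁻¹⁻¹ * (a⁻¹ * b⁻¹)⁻¹ = (a * b) ^ 2 := by field_simp
  rw [e] at h
  rw [h]; rfl

lemma dil3_emb {a b : ℝ} (ha : 0 < a) (hb : 0 < b) : MeasurableEmbedding (dil3 a b) :=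
  ((Homeomorph.mulLeft₀ (a * b)⁻¹ (by positivity)).prodCongr
    ((Homeomorph.mulLeft₀ a⁻¹ (by positivity)).prodCongr
      (Homeomorph.mulLeft₀ b⁻¹ (by positivity)))).measurableEmbedding

lemma dil3_lintegral {a b : ℝ} (ha : 0 < a) (hb : 0 < b) (g : ℝ × ℝ × ℝ → ℝ≥0∞) :
    ∫⁻ P, g (dil3 a b P) = ENNReal.ofReal ((a * b) ^ 2) * ∫⁻ P, g P := by
  rw [← (dil3_emb ha hb).lintegral_map, dil3_map ha hb, lintegral_smul_measure, smul_eq_mul]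

lemma extOp_dil {a b : ℝ} (ha : 0 < a) (hb : 0 < b) (f : ℝ × ℝ → ℂ) (P : ℝ × ℝ × ℝ) :
    extOp (fun ξ => f (dil a b ξ)) P = ((a * b)⁻¹ : ℝ) * extOp f (dil3 a b P) := by
  rw [extOp_eq, extOp_eq, ← dil_integral ha hb]
  congr 1; ext ξ
  congr 1
  unfold ph dil3 dil
  congr 3
  simp only
  field_simp

noncomputable def dilSet (a b : ℝ) (Ω : Set (ℝ × ℝ)) : Set (ℝ × ℝ) := dil a⁻¹ b⁻¹ ⁻¹' Ω

lemma dil_dil {a b : ℝ} (ha : 0 < a) (hb : 0 < b) (ξ : ℝ × ℝ) :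
    dil a⁻¹ b⁻¹ (dil a b ξ) = ξ := by
  unfold dil; ext <;> field_simp

lemma dilSet_meas {a b : ℝ} (ha : 0 < a) (hb : 0 < b) {Ω : Set (ℝ × ℝ)} (hΩ : MeasurableSet Ω) :
    MeasurableSet (dilSet a b Ω) :=
  (dil_emb (a := a⁻¹) (b := b⁻¹) (by positivity) (by positivity)).measurable hΩ

lemma chi_dil {a b : ℝ} (ha : 0 < a) (hb : 0 < b) (Ω Q : Set (ℝ × ℝ)) :
    chi (Ω ∩ dil a b ⁻¹' Q) = fun ξ => chi (dilSet a b Ω ∩ Q) (dil a b ξ) := by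
  ext ξ
  unfold chi dilSet
  classical
  simp only [indicator_apply, mem_inter_iff, mem_preimage, dil_dil ha hb]

lemma vol_dil {a b : ℝ} (ha : 0 < a) (hb : 0 < b) {Ω Q : Set (ℝ × ℝ)} (hΩ : MeasurableSet Ω)
    (hQ : MeasurableSet Q) :
    volume (dilSet a b Ω ∩ Q) = ENNReal.ofReal (a * b) * volume (Ω ∩ dil a b ⁻¹' Q) := by
  have h : (Measure.map (dil a b) volume) (dilSet a b Ω ∩ Q) = volume (Ω ∩ dil a b ⁻¹' Q) := by
    rw [Measure.map_apply (dil_emb ha hb).measurable ((dilSet_meas ha hb hΩ).inter hQ)]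
    congr 1
    ext ξ
    simp only [dilSet, mem_preimage, mem_inter_iff, dil_dil ha hb]
  rw [← h, dil_map ha hb, Measure.smul_apply, smul_eq_mul, ← mul_assoc,
    ← ENNReal.ofReal_mul (by positivity), mul_inv_cancel₀ (by positivity), ENNReal.ofReal_one,
    one_mul]

noncomputable def GG (a b : ℝ) (Ω : Set (ℝ × ℝ)) (I : ℤ × ℤ → Finset (ℤ × ℤ)) (P : ℝ × ℝ × ℝ) : ℂ :=
  ∑ d ∈ DD, ∑ m ∈ I d,
    extOp (chi (Ω ∩ dil a b ⁻¹' QQ m)) P * extOp (chi (Ω ∩ dil a b ⁻¹' QQ (m + d))) P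

lemma GG_eq {a b : ℝ} (ha : 0 < a) (hb : 0 < b) (Ω : Set (ℝ × ℝ))
    (I : ℤ × ℤ → Finset (ℤ × ℤ)) (P : ℝ × ℝ × ℝ) :
    GG a b Ω I P = (((a * b) ^ 2)⁻¹ : ℝ) * ∑ d ∈ DD, ∑ m ∈ I d,
        extOp (chi (dilSet a b Ω ∩ QQ m)) (dil3 a b P) *
          extOp (chi (dilSet a b Ω ∩ QQ (m + d))) (dil3 a b P) := by
  unfold GG
  rw [Finset.mul_sum]
  refine Finset.sum_congr rfl fun d _ => ?_
  rw [Finset.mul_sum]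
  refine Finset.sum_congr rfl fun m _ => ?_
  rw [chi_dil ha hb, chi_dil ha hb, extOp_dil ha hb, extOp_dil ha hb]
  push_cast; ring

lemma scaled_bound {s r A : ℝ} (hs : 1 ≤ s) (hs2 : s ≤ 2) (hr : 0 < r)
    (hsr : 0 ≤ 2 * (s / r) - 1)
    (hBH : BH s r A) {φ : ℝ → ℂ} {K : ℝ} (hK : 0 < K) (hφc : Continuous φ)
    (hφ : ∀ z, ‖φ z‖ ≤ vv K z)
    (hφ1 : ∀ u : ℝ, 0 ≤ u → u ≤ 2 →
      ∫ z : ℝ, Complex.exp (Complex.I * ((2 * Real.pi * z * u : ℝ) : ℂ)) * φ z = 1)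
    {a b : ℝ} (ha : 0 < a) (hb : 0 < b)
    {Ω : Set (ℝ × ℝ)} (hΩ : MeasurableSet Ω) (hfin : volume Ω ≠ ⊤) {M : ℝ≥0∞}
    (hM : ∀ m, volume (Ω ∩ dil a b ⁻¹' QQ m) ≤ M) (I : ℤ × ℤ → Finset (ℤ × ℤ)) :
    eLpNorm' (GG a b Ω I) s volume ≤
      (32 * BV K * ENNReal.ofReal A) * (ENNReal.ofReal ((a * b) ^ (-(2 - 2 / s - 2 / r))) *
        M ^ (2 / r - 1 / s) * volume Ω ^ (1 / s)) := by
  have hs0 : s ≠ 0 := by linarith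
  have hsp : 0 < s := by linarith
  have hab : 0 < a * b := by positivity
  have hvol : volume (dilSet a b Ω) = ENNReal.ofReal (a * b) * volume Ω := by
    simpa using vol_dil ha hb hΩ MeasurableSet.univ
  have h := unit_bound (M := ENNReal.ofReal (a * b) * M) hs hs2 hr hsr hBH hK hφc hφ hφ1
    (dilSet_meas ha hb hΩ)
    (by rw [hvol]; exact ENNReal.mul_ne_top ENNReal.ofReal_ne_top hfin)
    (fun m => by rw [vol_dil ha hb hΩ (QQ_meas m)]; gcongr; exact hM m) I
  rw [hvol] at h
  set G := fun P => ∑ d ∈ DD, ∑ m ∈ I d,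
        extOp (chi (dilSet a b Ω ∩ QQ m)) P *
          extOp (chi (dilSet a b Ω ∩ QQ (m + d))) P with hG
  set N : ℝ≥0∞ := ENNReal.ofReal (a * b) with hN
  have hN0 : N ≠ 0 := by simpa [hN] using hab
  have hNt : N ≠ ⊤ := ENNReal.ofReal_ne_top
  have e1 : eLpNorm' (GG a b Ω I) s volume = N ^ (-2 + 2 / s) * eLpNorm' G s volume := by
    unfold eLpNorm'
    have : ∀ P, ‖GG a b Ω I P‖ₑ ^ s = N ^ (-2 * s) * ‖G (dil3 a b P)‖ₑ ^ s := by
      intro P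
      rw [GG_eq ha hb, enorm_mul, ENNReal.mul_rpow_of_nonneg _ _ hsp.le, ENNReal.rpow_mul]
      congr 2
      rw [← ofReal_norm, Complex.norm_real, Real.norm_of_nonneg (by positivity), hN,
        ENNReal.ofReal_rpow_of_pos hab]
      congr 1
      rw [Real.rpow_neg hab.le]; norm_cast
    simp_rw [this]
    rw [lintegral_const_mul' _ _ (ENNReal.rpow_ne_top_of_ne_zero hN0 hNt),
      dil3_lintegral ha hb (fun P => ‖G P‖ₑ ^ s), ENNReal.ofReal_pow hab.le, ← hN, ← mul_assoc,
      ENNReal.mul_rpow_of_nonneg _ _ (by positivity)]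
    congr 1
    rw [← ENNReal.rpow_natCast, ← ENNReal.rpow_add _ _ hN0 hNt, ← ENNReal.rpow_mul]
    congr 1
    push_cast
    field_simp
  have he : 0 ≤ 2 / r - 1 / s := by
    have : 2 / r - 1 / s = (2 * (s / r) - 1) / s := by field_simp
    rw [this]; positivity
  rw [e1]
  calc N ^ (-2 + 2 / s) * eLpNorm' G s volume
      ≤ N ^ (-2 + 2 / s) * (16 * (BV K * (ENNReal.ofReal A *
        ((N * M) ^ (2 / r - 1 / s) * (2 * (N * volume Ω)) ^ (1 / s))))) := by gcongr
    _ = 2 ^ (1 / s) * ((16 * BV K * ENNReal.ofReal A) *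
        ((N ^ (-2 + 2 / s) * N ^ (2 / r - 1 / s) * N ^ (1 / s)) *
          M ^ (2 / r - 1 / s) * volume Ω ^ (1 / s))) := by
        rw [ENNReal.mul_rpow_of_nonneg _ _ he, ENNReal.mul_rpow_of_nonneg _ _ (by positivity),
          ENNReal.mul_rpow_of_nonneg _ _ (by positivity)]
        ring
    _ ≤ 2 ^ (1 : ℝ) * ((16 * BV K * ENNReal.ofReal A) *
        ((N ^ (-2 + 2 / s) * N ^ (2 / r - 1 / s) * N ^ (1 / s)) *
          M ^ (2 / r - 1 / s) * volume Ω ^ (1 / s))) := by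
        gcongr
        · norm_num
        · rw [div_le_one hsp]; exact hs
    _ = _ := by
        rw [← ENNReal.rpow_add _ _ hN0 hNt, ← ENNReal.rpow_add _ _ hN0 hNt,
          ← ENNReal.ofReal_rpow_of_pos hab, ← hN, ENNReal.rpow_one]
        have : -2 + 2 / s + (2 / r - 1 / s) + 1 / s = -(2 - 2 / s - 2 / r) := by ring
        rw [this]; ring

/-- The Whitney relation between dyadic intervals of the same generation. -/
def ww (a b : ℤ) : Prop := 2 ≤ |a - b| ∧ |a / 2 - b / 2| ≤ 1

lemma ww_diff {a b : ℤ} (h : ww a b) : b - a ∈ ({-3, -2, 2, 3} : Finset ℤ) := by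
  obtain ⟨h1, h2⟩ := h
  simp only [Finset.mem_insert, Finset.mem_singleton]
  rw [abs_le] at h2
  rw [le_abs] at h1
  omega

lemma floor_half (n : ℕ) (x : ℝ) : ⌊(2:ℝ) ^ (n + 1) * x⌋ / 2 = ⌊(2:ℝ) ^ n * x⌋ := by
  have h1 := Int.floor_le ((2:ℝ) ^ (n + 1) * x)
  have h2 := Int.lt_floor_add_one ((2:ℝ) ^ (n + 1) * x)
  have h3 := Int.floor_le ((2:ℝ) ^ n * x)
  have h4 := Int.lt_floor_add_one ((2:ℝ) ^ n * x)
  set a := ⌊(2:ℝ) ^ (n + 1) * x⌋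
  set b := ⌊(2:ℝ) ^ n * x⌋
  have e : (2:ℝ) ^ (n + 1) * x = 2 * (2 ^ n * x) := by ring
  rw [e] at h1 h2
  have h5 : 2 * b < a + 1 := by
    have : (2:ℝ) * b < a + 1 := by linarith
    exact_mod_cast this
  have h6 : a < 2 * b + 2 := by
    have : (a:ℝ) < 2 * b + 2 := by linarith
    exact_mod_cast this
  omega

/-- separation at generation n -/
def qq (x y : ℝ) (n : ℕ) : Prop := 2 ≤ |⌊(2:ℝ) ^ n * x⌋ - ⌊(2:ℝ) ^ n * y⌋|

lemma qq_succ {x y : ℝ} {n : ℕ} (h : qq x y n) : qq x y (n + 1) := by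
  unfold qq at *
  have h1 := floor_half n x
  have h2 := floor_half n y
  rw [le_abs] at *
  omega

lemma qq_mono {x y : ℝ} {n m : ℕ} (hnm : n ≤ m) (h : qq x y n) : qq x y m := by
  induction hnm with
  | refl => exact h
  | step _ ih => exact qq_succ ih

lemma ww_succ {x y : ℝ} {n : ℕ} :
    ww ⌊(2:ℝ) ^ (n + 1) * x⌋ ⌊(2:ℝ) ^ (n + 1) * y⌋ ↔ qq x y (n + 1) ∧ ¬ qq x y n := by
  unfold ww qq
  rw [floor_half, floor_half]
  refine and_congr Iff.rfl ?_
  rw [not_le]; omega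

lemma ww_unique {x y : ℝ} {n m : ℕ} (hn : ww ⌊(2:ℝ) ^ n * x⌋ ⌊(2:ℝ) ^ n * y⌋)
    (hm : ww ⌊(2:ℝ) ^ m * x⌋ ⌊(2:ℝ) ^ m * y⌋) : n = m := by
  have key : ∀ {n m : ℕ}, ww ⌊(2:ℝ) ^ n * x⌋ ⌊(2:ℝ) ^ n * y⌋ →
      ww ⌊(2:ℝ) ^ m * x⌋ ⌊(2:ℝ) ^ m * y⌋ → ¬ n < m := by
    intro n m hn hm hlt
    obtain ⟨k, rfl⟩ : ∃ k, m = k + 1 := ⟨m - 1, by omega⟩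
    exact (ww_succ.1 hm).2 (qq_mono (by omega) hn.1)
  have := key hn hm
  have := key hm hn
  omega

lemma ww_exists {x y : ℝ} (hx : x ∈ Icc (0:ℝ) 1) (hy : y ∈ Icc (0:ℝ) 1) (hxy : x ≠ y) :
    ∃ n : ℕ, ww ⌊(2:ℝ) ^ n * x⌋ ⌊(2:ℝ) ^ n * y⌋ := by
  classical
  have hex : ∃ n, qq x y n := by
    have hpos : 0 < |x - y| := abs_pos.2 (sub_ne_zero.2 hxy)
    obtain ⟨n, hn⟩ := pow_unbounded_of_one_lt (3 / |x - y|) (one_lt_two (α := ℝ))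
    refine ⟨n, ?_⟩
    rw [div_lt_iff₀ hpos] at hn
    have e : (2:ℝ) ^ n * |x - y| = |2 ^ n * x - 2 ^ n * y| := by
      rw [← mul_sub, abs_mul, abs_of_pos (by positivity : (0:ℝ) < 2 ^ n)]
    rw [e] at hn
    have h1 := Int.floor_le ((2:ℝ) ^ n * x)
    have h2 := Int.lt_floor_add_one ((2:ℝ) ^ n * x)
    have h3 := Int.floor_le ((2:ℝ) ^ n * y)
    have h4 := Int.lt_floor_add_one ((2:ℝ) ^ n * y)
    unfold qq
    set a := ⌊(2:ℝ) ^ n * x⌋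
    set b := ⌊(2:ℝ) ^ n * y⌋
    rw [lt_abs] at hn
    rw [le_abs]
    rcases hn with hn | hn
    · left
      have : (b:ℝ) + 2 < a + 0 + 0 := by linarith
      have : b + 2 < a + 0 + 0 := by exact_mod_cast this
      omega
    · right
      have : (a:ℝ) + 2 < b + 0 + 0 := by linarith
      have : a + 2 < b + 0 + 0 := by exact_mod_cast this
      omega
  have h0 : ¬ qq x y 0 := by
    unfold qq
    have f : ∀ z : ℝ, z ∈ Icc (0:ℝ) 1 → 0 ≤ ⌊(2:ℝ) ^ 0 * z⌋ ∧ ⌊(2:ℝ) ^ 0 * z⌋ ≤ 1 := by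
      intro z hz
      constructor
      · apply Int.floor_nonneg.2; simpa using hz.1
      · have : ((⌊(2:ℝ) ^ 0 * z⌋ : ℤ) : ℝ) ≤ (1:ℤ) := by
          refine (Int.floor_le _).trans ?_
          simpa using hz.2
        exact_mod_cast this
    have := f x hx
    have := f y hy
    rw [le_abs]; omega
  have hf := Nat.find_spec hex
  obtain ⟨k, hk⟩ : ∃ k, Nat.find hex = k + 1 := by
    refine ⟨Nat.find hex - 1, ?_⟩
    have : Nat.find hex ≠ 0 := by
      intro h; rw [h] at hf; exact h0 hf
    omega
  refine ⟨k + 1, ww_succ.2 ⟨hk ▸ hf, Nat.find_min hex (by omega)⟩⟩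

/-- The Whitney region. -/
def WB (Ω : Set (ℝ × ℝ)) (n : ℕ × ℕ) : Set ((ℝ × ℝ) × (ℝ × ℝ)) :=
  {q | (q.1 ∈ Ω ∧ q.2 ∈ Ω) ∧ ww ⌊(2:ℝ) ^ n.1 * q.1.1⌋ ⌊(2:ℝ) ^ n.1 * q.2.1⌋ ∧
    ww ⌊(2:ℝ) ^ n.2 * q.1.2⌋ ⌊(2:ℝ) ^ n.2 * q.2.2⌋}

lemma WB_meas {Ω : Set (ℝ × ℝ)} (hΩ : MeasurableSet Ω) (n : ℕ × ℕ) : MeasurableSet (WB Ω n) := by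
  have hW : MeasurableSet {p : ℤ × ℤ | ww p.1 p.2} :=
    (Set.to_countable _).measurableSet
  have m1 : Measurable fun q : (ℝ × ℝ) × (ℝ × ℝ) =>
      (⌊(2:ℝ) ^ n.1 * q.1.1⌋, ⌊(2:ℝ) ^ n.1 * q.2.1⌋) := by
    refine Measurable.prodMk ?_ ?_ <;> exact Int.measurable_floor.comp (by fun_prop)
  have m2 : Measurable fun q : (ℝ × ℝ) × (ℝ × ℝ) =>
      (⌊(2:ℝ) ^ n.2 * q.1.2⌋, ⌊(2:ℝ) ^ n.2 * q.2.2⌋) := by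
    refine Measurable.prodMk ?_ ?_ <;> exact Int.measurable_floor.comp (by fun_prop)
  exact ((measurable_fst hΩ).inter (measurable_snd hΩ)).inter ((m1 hW).inter (m2 hW))

lemma WB_disj (Ω : Set (ℝ × ℝ)) : Pairwise (Function.onFun Disjoint (WB Ω)) := by
  intro n m hnm
  rw [Function.onFun, Set.disjoint_left]
  rintro q ⟨_, h1, h2⟩ ⟨_, h3, h4⟩
  exact hnm (Prod.ext (ww_unique h1 h3) (ww_unique h2 h4))

lemma ae_ne : ∀ᵐ q : (ℝ × ℝ) × (ℝ × ℝ), q.1.1 ≠ q.2.1 ∧ q.1.2 ≠ q.2.2 := by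
  have hd : ∀ (f : (ℝ × ℝ) → ℝ), Measurable f → (∀ c, ∀ᵐ y : ℝ × ℝ, f y ≠ c) →
      ∀ᵐ q : (ℝ × ℝ) × (ℝ × ℝ), f q.1 ≠ f q.2 := by
    intro f hf hc
    have hm : MeasurableSet {q : (ℝ × ℝ) × (ℝ × ℝ) | f q.1 = f q.2} :=
      measurableSet_eq_fun (hf.comp measurable_fst) (hf.comp measurable_snd)
    rw [ae_iff]
    simp only [not_not]
    rw [Measure.volume_eq_prod, Measure.measure_prod_null hm]
    refine Filter.Eventually.of_forall fun x => ?_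
    have := hc (f x)
    rw [ae_iff] at this
    refine measure_mono_null ?_ this
    intro y hy
    simpa using (show f x = f y from hy).symm
  have h1 : ∀ c : ℝ, ∀ᵐ y : ℝ × ℝ, y.1 ≠ c := fun c =>
    Measure.quasiMeasurePreserving_fst.ae (Measure.ae_ne volume c)
  have h2 : ∀ c : ℝ, ∀ᵐ y : ℝ × ℝ, y.2 ≠ c := fun c =>
    Measure.quasiMeasurePreserving_snd.ae (Measure.ae_ne volume c)
  filter_upwards [hd _ measurable_fst h1, hd _ measurable_snd h2] with q a b using ⟨a, b⟩

lemma chi_mul_int {Ω₁ Ω₂ : Set (ℝ × ℝ)} (hΩ₁ : MeasurableSet Ω₁) (hfin₁ : volume Ω₁ ≠ ⊤)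
    (hΩ₂ : MeasurableSet Ω₂) (hfin₂ : volume Ω₂ ≠ ⊤) (P : ℝ × ℝ × ℝ) :
    Integrable fun q : (ℝ × ℝ) × (ℝ × ℝ) =>
      (ph P q.1 * ph P q.2) * (chi Ω₁ q.1 * chi Ω₂ q.2) := by
  have hc : Continuous fun q : (ℝ × ℝ) × (ℝ × ℝ) => ph P q.1 * ph P q.2 :=
    ((ph_cont2 P).comp continuous_fst).mul ((ph_cont2 P).comp continuous_snd)
  exact int_aux (chi_int hΩ₁ hfin₁) (chi_int hΩ₂ hfin₂) _ hc.aestronglyMeasurable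
    (fun q => by rw [norm_mul, norm_ph, norm_ph]; norm_num)

lemma whitney_hasSum {Ω : Set (ℝ × ℝ)} (hΩ : MeasurableSet Ω) (hfin : volume Ω ≠ ⊤)
    (hsub : Ω ⊆ Icc 0 1 ×ˢ Icc 0 1) (P : ℝ × ℝ × ℝ) :
    HasSum (fun n : ℕ × ℕ => ∫ q in WB Ω n, (ph P q.1 * ph P q.2) * (chi Ω q.1 * chi Ω q.2))
      (extOp (chi Ω) P * extOp (chi Ω) P) := by
  have h := hasSum_integral_iUnion (WB_meas hΩ) (WB_disj Ω)
    ((chi_mul_int hΩ hfin hΩ hfin P).integrableOn (s := ⋃ n, WB Ω n))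
  rw [extOp_mul]
  refine (setIntegral_eq_integral_of_ae_compl_eq_zero ?_).subst
    (motive := fun z => HasSum _ z) h
  filter_upwards [ae_ne] with q hq hqn
  by_contra hne
  have h0 := right_ne_zero_of_mul hne
  have hq1 : q.1 ∈ Ω := chi_supp _ (left_ne_zero_of_mul h0)
  have hq2 : q.2 ∈ Ω := chi_supp _ (right_ne_zero_of_mul h0)
  obtain ⟨j, hj⟩ := ww_exists (hsub hq1).1 (hsub hq2).1 hq.1
  obtain ⟨k, hk⟩ := ww_exists (hsub hq1).2 (hsub hq2).2 hq.2
  exact hqn (mem_iUnion.2 ⟨(j, k), ⟨hq1, hq2⟩, hj, hk⟩)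

open Classical in
/-- index sets -/
noncomputable def II (n : ℕ × ℕ) (d : ℤ × ℤ) : Finset (ℤ × ℤ) :=
  (Finset.Icc (0:ℤ) (2 ^ n.1) ×ˢ Finset.Icc (0:ℤ) (2 ^ n.2)).filter
    fun m => ww m.1 (m + d).1 ∧ ww m.2 (m + d).2

lemma floor_mem (n : ℕ) {x : ℝ} (hx : x ∈ Icc (0:ℝ) 1) :
    ⌊(2:ℝ) ^ n * x⌋ ∈ Finset.Icc (0:ℤ) (2 ^ n) := by
  rw [Finset.mem_Icc]
  constructor
  · apply Int.floor_nonneg.2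
    have := hx.1
    positivity
  · have : ((⌊(2:ℝ) ^ n * x⌋ : ℤ) : ℝ) ≤ ((2 ^ n : ℤ) : ℝ) := by
      refine (Int.floor_le _).trans ?_
      push_cast
      exact mul_le_of_le_one_right (by positivity) hx.2
    exact_mod_cast this

lemma dil_mem {a b : ℝ} {ξ : ℝ × ℝ} {m : ℤ × ℤ} :
    ξ ∈ dil a b ⁻¹' QQ m ↔ (⌊a * ξ.1⌋, ⌊b * ξ.2⌋) = m := by
  simp only [mem_preimage, QQ, dil, mem_ofPred_eq, Prod.ext_iff]

open Classical in
lemma point_id {Ω : Set (ℝ × ℝ)} (hsub : Ω ⊆ Icc 0 1 ×ˢ Icc 0 1) (n : ℕ × ℕ)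
    (q : (ℝ × ℝ) × (ℝ × ℝ)) :
    (WB Ω n).indicator (fun q => chi Ω q.1 * chi Ω q.2) q =
      ∑ d ∈ DD, ∑ m ∈ II n d, chi (Ω ∩ dil (2 ^ n.1) (2 ^ n.2) ⁻¹' QQ m) q.1 *
        chi (Ω ∩ dil (2 ^ n.1) (2 ^ n.2) ⁻¹' QQ (m + d)) q.2 := by
  set m₀ : ℤ × ℤ := (⌊(2:ℝ) ^ n.1 * q.1.1⌋, ⌊(2:ℝ) ^ n.2 * q.1.2⌋) with hm₀
  set m₁ : ℤ × ℤ := (⌊(2:ℝ) ^ n.1 * q.2.1⌋, ⌊(2:ℝ) ^ n.2 * q.2.2⌋) with hm₁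
  have hterm : ∀ d m, chi (Ω ∩ dil (2 ^ n.1) (2 ^ n.2) ⁻¹' QQ m) q.1 *
        chi (Ω ∩ dil (2 ^ n.1) (2 ^ n.2) ⁻¹' QQ (m + d)) q.2 ≠ 0 →
        q.1 ∈ Ω ∧ q.2 ∈ Ω ∧ m = m₀ ∧ d = m₁ - m₀ := by
    intro d m h
    have h1 := chi_supp _ (left_ne_zero_of_mul h)
    have h2 := chi_supp _ (right_ne_zero_of_mul h)
    have e1 := dil_mem.1 h1.2
    have e2 := dil_mem.1 h2.2
    refine ⟨h1.1, h2.1, e1.symm, ?_⟩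
    have e1' : m₀ = m := e1
    have e2' : m₁ = m + d := e2
    rw [e1', e2', add_sub_cancel_left]
  by_cases hq : q ∈ WB Ω n
  · rw [indicator_of_mem hq]
    obtain ⟨⟨hq1, hq2⟩, w1, w2⟩ := hq
    have hd : m₁ - m₀ ∈ DD := by
      rw [DD, Finset.mem_product]
      exact ⟨ww_diff w1, ww_diff w2⟩
    have hm : m₀ ∈ II n (m₁ - m₀) := by
      rw [II, Finset.mem_filter, Finset.mem_product, add_sub_cancel]
      exact ⟨⟨floor_mem _ (hsub hq1).1, floor_mem _ (hsub hq1).2⟩, w1, w2⟩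
    rw [Finset.sum_eq_single_of_mem _ hd, Finset.sum_eq_single_of_mem _ hm]
    · have a1 : q.1 ∈ Ω ∩ dil (2 ^ n.1) (2 ^ n.2) ⁻¹' QQ m₀ := ⟨hq1, dil_mem.2 rfl⟩
      have a2 : q.2 ∈ Ω ∩ dil (2 ^ n.1) (2 ^ n.2) ⁻¹' QQ (m₀ + (m₁ - m₀)) :=
        ⟨hq2, dil_mem.2 (by rw [add_sub_cancel])⟩
      unfold chi
      rw [indicator_of_mem a1, indicator_of_mem a2, indicator_of_mem hq1, indicator_of_mem hq2]
    · intro m _ hne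
      by_contra h
      exact hne (hterm _ _ h).2.2.1
    · intro d _ hne
      refine Finset.sum_eq_zero fun m _ => ?_
      by_contra h
      exact hne (hterm _ _ h).2.2.2
  · rw [indicator_of_notMem hq]
    symm
    refine Finset.sum_eq_zero fun d _ => Finset.sum_eq_zero fun m hm => ?_
    by_contra h
    obtain ⟨a1, a2, rfl, rfl⟩ := hterm _ _ h
    rw [II, Finset.mem_filter, add_sub_cancel] at hm
    exact hq ⟨⟨a1, a2⟩, hm.2.1, hm.2.2⟩

lemma WB_integral {Ω : Set (ℝ × ℝ)} (hΩ : MeasurableSet Ω) (hfin : volume Ω ≠ ⊤)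
    (hsub : Ω ⊆ Icc 0 1 ×ˢ Icc 0 1) (P : ℝ × ℝ × ℝ) (n : ℕ × ℕ) :
    ∫ q in WB Ω n, (ph P q.1 * ph P q.2) * (chi Ω q.1 * chi Ω q.2) =
      GG (2 ^ n.1) (2 ^ n.2) Ω (II n) P := by
  have hme : ∀ m, MeasurableSet (Ω ∩ dil ((2:ℝ) ^ n.1) (2 ^ n.2) ⁻¹' QQ m) := fun m =>
    hΩ.inter ((by unfold dil; fun_prop : Measurable (dil ((2:ℝ) ^ n.1) (2 ^ n.2))) (QQ_meas m))
  have hfi : ∀ m, volume (Ω ∩ dil ((2:ℝ) ^ n.1) (2 ^ n.2) ⁻¹' QQ m) ≠ ⊤ := fun m =>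
    ne_top_of_le_ne_top hfin (measure_mono inter_subset_left)
  unfold GG
  simp_rw [extOp_mul]
  rw [← integral_indicator (WB_meas hΩ n)]
  have e : ∀ d ∈ DD, ∑ m ∈ II n d, ∫ q : (ℝ × ℝ) × (ℝ × ℝ), (ph P q.1 * ph P q.2) *
      (chi (Ω ∩ dil (2 ^ n.1) (2 ^ n.2) ⁻¹' QQ m) q.1 *
        chi (Ω ∩ dil (2 ^ n.1) (2 ^ n.2) ⁻¹' QQ (m + d)) q.2) =
      ∫ q : (ℝ × ℝ) × (ℝ × ℝ), ∑ m ∈ II n d, (ph P q.1 * ph P q.2) *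
      (chi (Ω ∩ dil (2 ^ n.1) (2 ^ n.2) ⁻¹' QQ m) q.1 *
        chi (Ω ∩ dil (2 ^ n.1) (2 ^ n.2) ⁻¹' QQ (m + d)) q.2) := fun d _ =>
    (integral_finsetSum _ fun m _ => chi_mul_int (hme _) (hfi _) (hme _) (hfi _) P).symm
  rw [Finset.sum_congr rfl e, ← integral_finsetSum _ fun d _ =>
    integrable_finsetSum _ fun m _ => chi_mul_int (hme _) (hfi _) (hme _) (hfi _) P]
  congr 1; ext q
  simp_rw [← Finset.mul_sum]
  rw [← point_id hsub n q]
  by_cases hq : q ∈ WB Ω n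
  · rw [indicator_of_mem hq, indicator_of_mem hq]
  · rw [indicator_of_notMem hq, indicator_of_notMem hq, mul_zero]

lemma QQ_tile (n : ℕ × ℕ) (m : ℤ × ℤ) :
    dil ((2:ℝ) ^ n.1) (2 ^ n.2) ⁻¹' QQ m ⊆ tile (n.1 : ℤ) (n.2 : ℤ) m.1 m.2 := by
  have key : ∀ (n : ℕ) (x : ℝ) (m : ℤ), ⌊(2:ℝ) ^ n * x⌋ = m → x ∈ dyadicIcc (n : ℤ) m := by
    intro n x m h
    rw [Int.floor_eq_iff] at h
    have hp : (0:ℝ) < 2 ^ n := by positivity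
    rw [dyadicIcc, zpow_neg, zpow_natCast, mem_Icc, ← div_eq_mul_inv, ← div_eq_mul_inv,
      div_le_iff₀ hp, le_div_iff₀ hp]
    constructor <;> nlinarith [h.1, h.2]
  rintro ξ ⟨h1, h2⟩
  exact ⟨key _ _ _ h1, key _ _ _ h2⟩

lemma GG_cont {Ω : Set (ℝ × ℝ)} (hΩ : MeasurableSet Ω) (hfin : volume Ω ≠ ⊤) (a b : ℝ)
    (I : ℤ × ℤ → Finset (ℤ × ℤ)) : Continuous (GG a b Ω I) := by
  have hc : ∀ m, Continuous (extOp (chi (Ω ∩ dil a b ⁻¹' QQ m))) := fun m =>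
    extOp_cont (chi_int (hΩ.inter ((by unfold dil; fun_prop : Measurable (dil a b)) (QQ_meas m)))
      (ne_top_of_le_ne_top hfin (measure_mono inter_subset_left)))
  unfold GG
  exact continuous_finsetSum _ fun d _ => continuous_finsetSum _ fun m _ => (hc _).mul (hc _)

lemma lim_bound {s : ℝ} (hs : 1 ≤ s) {F : ℝ × ℝ × ℝ → ℂ} {g : ℕ × ℕ → ℝ × ℝ × ℝ → ℂ}
    (hg : ∀ n, Continuous (g n)) (hF : ∀ P, HasSum (fun n => g n P) (F P)) :
    eLpNorm' F s volume ≤ ∑' n : ℕ × ℕ, eLpNorm' (g n) s volume := by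
  set e := Nat.pairEquiv.symm
  have h := Lp.eLpNorm'_lim_le_liminf_eLpNorm' (μ := (volume : Measure (ℝ × ℝ × ℝ)))
    (p := s) (by linarith) (f := fun N => ∑ i ∈ Finset.range N, g (e i)) (f_lim := F)
    (fun N => Finset.aestronglyMeasurable_sum _ fun i _ => (hg _).aestronglyMeasurable)
    (Filter.Eventually.of_forall fun P => by
      have := ((e.hasSum_iff).2 (hF P)).tendsto_sum_nat
      simpa [Finset.sum_apply] using this)
  refine h.trans ?_
  refine Filter.liminf_le_of_le (by isBoundedDefault) ?_
  intro b hb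
  obtain ⟨N, hN⟩ := hb.exists
  refine hN.trans ((eLpNorm'_sum_le (fun i _ => (hg _).aestronglyMeasurable) hs).trans ?_)
  rw [← e.tsum_eq]
  exact ENNReal.sum_le_tsum _

lemma sq_norm {s : ℝ} (hs : 0 < s) (f : ℝ × ℝ × ℝ → ℂ) :
    eLpNorm f (ENNReal.ofReal (2 * s)) volume ^ (2 : ℝ) =
      eLpNorm' (fun P => f P * f P) s volume := by
  rw [eLpNorm_eq_lintegral_rpow_enorm_toReal (by simpa using hs) ENNReal.ofReal_ne_top,
    ENNReal.toReal_ofReal (by linarith), ← ENNReal.rpow_mul]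
  unfold eLpNorm'
  have : ∀ P, ‖f P * f P‖ₑ ^ s = ‖f P‖ₑ ^ (2 * s) := by
    intro P
    rw [enorm_mul, ENNReal.rpow_mul, ← pow_two, ← ENNReal.rpow_natCast]
    norm_num
  simp_rw [this]
  congr 1
  field_simp

lemma main_bound {s r A : ℝ} (hs : 1 ≤ s) (hs2 : s ≤ 2) (hr : 0 < r)
    (hsr : 0 ≤ 2 * (s / r) - 1) (hBH : BH s r A) {φ : ℝ → ℂ} {K : ℝ} (hK : 0 < K)
    (hφc : Continuous φ) (hφ : ∀ z, ‖φ z‖ ≤ vv K z)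
    (hφ1 : ∀ u : ℝ, 0 ≤ u → u ≤ 2 →
      ∫ z : ℝ, Complex.exp (Complex.I * ((2 * Real.pi * z * u : ℝ) : ℂ)) * φ z = 1)
    {Ω : Set (ℝ × ℝ)} (hΩ : MeasurableSet Ω) (hsub : Ω ⊆ Icc 0 1 ×ˢ Icc 0 1) :
    eLpNorm (extOp (chi Ω)) (ENNReal.ofReal (2 * s)) volume ^ (2 : ℝ) ≤
      (32 * BV K * ENNReal.ofReal A) *
        ∑' j : ℕ, ∑' k : ℕ,
          ENNReal.ofReal (2 ^ (-((j : ℝ) + (k : ℝ)) * (2 - 2 / s - 2 / r))) *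
            (⨆ m : ℤ, ⨆ m' : ℤ, volume (Ω ∩ tile (j : ℤ) (k : ℤ) m m')) ^ (2 / r - 1 / s) *
            volume Ω ^ (1 / s) := by
  have hfin : volume Ω ≠ ⊤ := by
    refine ne_top_of_le_ne_top ?_ (measure_mono hsub)
    exact (isCompact_Icc.prod isCompact_Icc).measure_lt_top.ne
  rw [sq_norm (by linarith)]
  refine (lim_bound hs (g := fun n => GG (2 ^ n.1) (2 ^ n.2) Ω (II n))
    (fun n => GG_cont hΩ hfin _ _ _) (fun P => ?_)).trans ?_
  · have := whitney_hasSum hΩ hfin hsub P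
    simp_rw [WB_integral hΩ hfin hsub P] at this
    exact this
  rw [← ENNReal.tsum_prod (f := fun j k : ℕ =>
          ENNReal.ofReal (2 ^ (-((j : ℝ) + (k : ℝ)) * (2 - 2 / s - 2 / r))) *
            (⨆ m : ℤ, ⨆ m' : ℤ, volume (Ω ∩ tile (j : ℤ) (k : ℤ) m m')) ^ (2 / r - 1 / s) *
            volume Ω ^ (1 / s)), ← ENNReal.tsum_mul_left]
  refine ENNReal.tsum_le_tsum fun n => ?_
  have h := scaled_bound (a := 2 ^ n.1) (b := 2 ^ n.2)
    (M := ⨆ m : ℤ, ⨆ m' : ℤ, volume (Ω ∩ tile (n.1 : ℤ) (n.2 : ℤ) m m'))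
    hs hs2 hr hsr hBH hK hφc hφ hφ1 (by positivity)
    (by positivity) hΩ hfin (fun m => (measure_mono (inter_subset_inter_right _ (QQ_tile n m))).trans
      (le_iSup₂_of_le m.1 m.2 le_rfl)) (II n)
  refine h.trans (le_of_eq ?_)
  congr 4
  rw [← pow_add, ← Real.rpow_natCast, ← Real.rpow_mul (by norm_num)]
  push_cast
  congr 1; ring

/-- Whitney decomposition plus bilinear input: under BH(s,r) with
`3/2 < s < 2`, `r < s'`, there is `C` such that for every measurable `Ω' ⊆ [0,1]²`,
`∥𝓔χ_{Ω'}∥_{L^{2s}}² ≤ C Σ_{j,k ≥ 0} 2^{-(j+k)(2-2/s-2/r)} (max_{τ ∈ 𝓓_{j,k}} |Ω' ∩ τ|)^{2/r - 1/s} |Ω'|^{1/s}`. -/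
theorem stmt7 (s r A : ℝ) (hs₁ : 3 / 2 < s) (hs₂ : s < 2) (hr : r < s / (s - 1))
    (hBH : BH s r A) :
    ∃ C : ℝ, 0 < C ∧
      ∀ Ω' : Set (ℝ × ℝ), MeasurableSet Ω' → Ω' ⊆ Icc 0 1 ×ˢ Icc 0 1 →
        eLpNorm (extOp (chi Ω')) (ENNReal.ofReal (2 * s)) volume ^ (2 : ℝ) ≤
          ENNReal.ofReal C *
            ∑' j : ℕ, ∑' k : ℕ,
              ENNReal.ofReal (2 ^ (-((j : ℝ) + (k : ℝ)) * (2 - 2 / s - 2 / r))) *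
                (⨆ m : ℤ, ⨆ m' : ℤ, volume (Ω' ∩ tile (j : ℤ) (k : ℤ) m m')) ^ (2 / r - 1 / s) *
                volume Ω' ^ (1 / s) := by
  obtain ⟨φ, K, hK, hφc, hφ, hφ1⟩ := kernel_exists
  rcases le_or_gt r 0 with hr0 | hr0
  · refine ⟨1, one_pos, fun Ω hΩ hsub => ?_⟩
    have hBH' : BH s 1 0 := by
      intro a₁ a₂ b₁ b₂ h1 h2 h3 h4 f g hf hg
      have := hBH a₁ a₂ b₁ b₂ h1 h2 h3 h4 f g hf hg
      rw [ENNReal.ofReal_of_nonpos hr0] at this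
      refine this.trans ?_
      simp
    have h := main_bound (by linarith) hs₂.le one_pos (by linarith) hBH' hK hφc hφ hφ1 hΩ hsub
    refine h.trans ?_
    simp
  · have hsr : 0 ≤ 2 * (s / r) - 1 := by
      rw [lt_div_iff₀ (by linarith)] at hr
      have : 1 ≤ 2 * (s / r) := by
        rw [← mul_div_assoc, le_div_iff₀ hr0]
        nlinarith
      linarith
    have hC : 32 * BV K * ENNReal.ofReal A ≠ ⊤ :=
      ENNReal.mul_ne_top (ENNReal.mul_ne_top (by norm_num) (BV_top K)) ENNReal.ofReal_ne_top
    refine ⟨(32 * BV K * ENNReal.ofReal A).toReal + 1, by positivity, fun Ω hΩ hsub => ?_⟩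
    have h := main_bound (by linarith) hs₂.le hr0 hsr hBH hK hφc hφ hφ1 hΩ hsub
    refine h.trans ?_
    gcongr
    rw [ENNReal.ofReal_add ENNReal.toReal_nonneg zero_le_one, ENNReal.ofReal_toReal hC]
    exact le_self_add
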